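/- arXiv:2407.05882 — 2 statements merged into one kernel-verified Lean document; each statement's English description precedes it below -/
import Mathlib

section
/- Let n ≥ 1 and 1 < p < 2. There exists a constant C > 0, depending only on n and p, such that for every u ∈ C_c^∞(ℝⁿ) one has ‖D²u‖_{L^p(ℝⁿ)} ≤ C ‖Δu‖_{L^p(ℝⁿ)}, i.e. (∫_{ℝⁿ} |D²u|^p)^{1/p} ≤ C (∫_{ℝⁿ} |Δu|^p)^{1/p}. -/
open MeasureTheory Metric ENNReal

/-- Partial derivative of `u : ℝⁿ → ℝ` in the `i`-th coordinate direction. -/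
noncomputable def partialDeriv' {n : ℕ} (i : Fin n)
    (u : EuclideanSpace ℝ (Fin n) → ℝ) : EuclideanSpace ℝ (Fin n) → ℝ :=
  fun x => fderiv ℝ u x (EuclideanSpace.single i 1)

/-- Entry `(i, j)` of the Hessian matrix `D²u`, i.e. `∂_j ∂_i u`. -/
noncomputable def hessEntry {n : ℕ} (u : EuclideanSpace ℝ (Fin n) → ℝ)
    (i j : Fin n) : EuclideanSpace ℝ (Fin n) → ℝ :=
  partialDeriv' j (partialDeriv' i u)

/-- Squared Frobenius norm `|D²u(x)|²` of the Hessian. -/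
noncomputable def hessFrobSq {n : ℕ} (u : EuclideanSpace ℝ (Fin n) → ℝ)
    (x : EuclideanSpace ℝ (Fin n)) : ℝ :=
  ∑ i, ∑ j, (hessEntry u i j x) ^ 2

/-- Laplacian `Δu = tr D²u`. -/
noncomputable def lap {n : ℕ} (u : EuclideanSpace ℝ (Fin n) → ℝ)
    (x : EuclideanSpace ℝ (Fin n)) : ℝ :=
  ∑ i, hessEntry u i i x

/-- Smooth compactly supported functions on `ℝⁿ`. -/
def IsTestFun {n : ℕ} (h : EuclideanSpace ℝ (Fin n) → ℝ) : Prop :=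
  ContDiff ℝ (⊤ : ℕ∞) h ∧ HasCompactSupport h

namespace IsTestFun

variable {n : ℕ} {h : EuclideanSpace ℝ (Fin n) → ℝ}

lemma differentiable (hh : IsTestFun h) : Differentiable ℝ h :=
  hh.1.differentiable (by simp)

lemma continuous (hh : IsTestFun h) : Continuous h := hh.1.continuous

lemma partialDeriv' (hh : IsTestFun h) (i : Fin n) : IsTestFun (partialDeriv' i h) := by
  refine ⟨?_, ?_⟩
  · exact (hh.1.fderiv_right (m := (⊤ : ℕ∞)) (by simp)).clm_apply contDiff_const
  · exact (hh.2.fderiv ℝ).comp_left (g := fun L : EuclideanSpace ℝ (Fin n) →L[ℝ] ℝ =>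
      L (EuclideanSpace.single i 1)) rfl

lemma hessEntry (hh : IsTestFun h) (i j : Fin n) : IsTestFun (hessEntry h i j) :=
  (hh.partialDeriv' i).partialDeriv' j

lemma sum {ι : Type*} (s : Finset ι) {f : ι → EuclideanSpace ℝ (Fin n) → ℝ}
    (hf : ∀ i ∈ s, IsTestFun (f i)) : IsTestFun (fun x => ∑ i ∈ s, f i x) := by
  classical
  induction s using Finset.induction_on with
  | empty => exact ⟨by simpa using contDiff_const, HasCompactSupport.zero⟩
  | insert a s ha ih =>
    have h1 := hf a (by simp)
    have h2 := ih fun i hi => hf i (by simp [hi])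
    simp only [Finset.sum_insert ha]
    exact ⟨h1.1.add h2.1, h1.2.add h2.2⟩

lemma lap (hh : IsTestFun h) : IsTestFun (lap h) :=
  sum _ fun i _ => hh.hessEntry i i

lemma exists_bound (hh : IsTestFun h) : ∃ M, 0 ≤ M ∧ ∀ x, |h x| ≤ M := by
  obtain ⟨M, hM⟩ := hh.2.exists_bound_of_continuous hh.continuous
  exact ⟨M, (norm_nonneg _).trans (hM 0), hM⟩

lemma exists_support_bound (hh : IsTestFun h) : ∃ R, 0 ≤ R ∧ ∀ x, R < ‖x‖ → h x = 0 := by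
  obtain ⟨R, hR⟩ := hh.2.isCompact.isBounded.exists_norm_le
  refine ⟨max R 0, le_max_right _ _, fun x hx => ?_⟩
  by_contra h0
  exact absurd (hR x (subset_tsupport _ h0)) (not_le.2 ((le_max_left _ _).trans_lt hx))

lemma integrable (hh : IsTestFun h) : Integrable h :=
  hh.continuous.integrable_of_hasCompactSupport hh.2

lemma partialDeriv'_comm (hh : IsTestFun h) (i j : Fin n) :
    _root_.partialDeriv' i (_root_.partialDeriv' j h) =
      _root_.partialDeriv' j (_root_.partialDeriv' i h) := by
  have hd : Differentiable ℝ (fderiv ℝ h) :=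
    (hh.1.fderiv_right (m := (⊤ : ℕ∞)) (by simp)).differentiable (by simp)
  have key : ∀ (v w x : EuclideanSpace ℝ (Fin n)),
      fderiv ℝ (fun y => fderiv ℝ h y v) x w = fderiv ℝ (fderiv ℝ h) x w v := by
    intro v w x
    rw [fderiv_clm_apply (hd x) (differentiableAt_const v)]
    simp
  funext x
  have hs : IsSymmSndFDerivAt ℝ h x := hh.1.contDiffAt.isSymmSndFDerivAt (by
    rw [minSmoothness_of_isRCLikeNormedField]; exact WithTop.coe_le_coe.2 (le_top : (2 : ℕ∞) ≤ ⊤))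
  exact (key _ _ x).trans ((hs _ _).trans (key _ _ x).symm)

lemma partialDeriv'_sum {ι : Type*} (s : Finset ι) {f : ι → EuclideanSpace ℝ (Fin n) → ℝ}
    (hf : ∀ i ∈ s, IsTestFun (f i)) (j : Fin n) :
    _root_.partialDeriv' j (fun x => ∑ i ∈ s, f i x) =
      fun x => ∑ i ∈ s, _root_.partialDeriv' j (f i) x := by
  funext x
  simp only [_root_.partialDeriv']
  rw [fderiv_fun_sum fun i hi => (hf i hi).differentiable x]
  simp

/-- The Laplacian commutes with partial derivatives. -/
lemma lap_partialDeriv' (hh : IsTestFun h) (j : Fin n) :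
    _root_.lap (_root_.partialDeriv' j h) = _root_.partialDeriv' j (_root_.lap h) := by
  have : _root_.partialDeriv' j (_root_.lap h) =
      fun x => ∑ i, _root_.partialDeriv' j (_root_.hessEntry h i i) x :=
    partialDeriv'_sum _ (fun i _ => hh.hessEntry i i) j
  rw [this]
  funext x
  refine Finset.sum_congr rfl fun i _ => ?_
  simp only [_root_.hessEntry]
  rw [hh.partialDeriv'_comm i j, (hh.partialDeriv' i).partialDeriv'_comm i j]

end IsTestFun

/-- The Gaussian probability density on `ℝⁿ`. -/
noncomputable def gaussWeight {n : ℕ} (y : EuclideanSpace ℝ (Fin n)) : ℝ :=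
  (∫ z : EuclideanSpace ℝ (Fin n), Real.exp (-(‖z‖ ^ 2 / 2)))⁻¹ * Real.exp (-(‖y‖ ^ 2 / 2))

section Gauss

variable {n : ℕ}

lemma exp_neg_sq_half_le (N : ℕ) {t : ℝ} (ht : 0 ≤ t) :
    Real.exp (-(t ^ 2 / 2)) ≤ Real.exp (3 / 2) * N.factorial * (1 + t) ^ (-(N : ℝ)) := by
  have h1 := Real.pow_div_factorial_le_exp (1 + t) (by linarith) N
  have h2 : Real.exp (-(t ^ 2 / 2)) ≤ Real.exp (3 / 2) * (Real.exp (1 + t))⁻¹ := by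
    rw [← Real.exp_neg, ← Real.exp_add]
    exact Real.exp_le_exp.2 (by nlinarith [sq_nonneg (t - 1)])
  refine h2.trans ?_
  rw [mul_assoc, Real.rpow_neg (by linarith), Real.rpow_natCast]
  gcongr
  have hN : (0 : ℝ) < N.factorial := by exact_mod_cast N.factorial_pos
  have hp : 0 < (1 + t) ^ N := by positivity
  rw [← div_eq_mul_inv, inv_le_comm₀ (Real.exp_pos _) (by positivity), inv_div]
  exact h1

lemma integrable_exp_moment (k : ℕ) :
    Integrable fun y : EuclideanSpace ℝ (Fin n) =>
      (1 + ‖y‖) ^ k * Real.exp (-(‖y‖ ^ 2 / 2)) := by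
  have hI : Integrable fun y : EuclideanSpace ℝ (Fin n) => (1 + ‖y‖) ^ (-((n : ℝ) + 1)) :=
    integrable_one_add_norm (by simp)
  refine (hI.const_mul (Real.exp (3 / 2) * (k + (n + 1)).factorial)).mono'
    (by fun_prop) (Filter.Eventually.of_forall fun y => ?_)
  have h0 : 0 < 1 + ‖y‖ := by positivity
  rw [Real.norm_of_nonneg (by positivity)]
  calc (1 + ‖y‖) ^ k * Real.exp (-(‖y‖ ^ 2 / 2))
      ≤ (1 + ‖y‖) ^ k * (Real.exp (3 / 2) * (k + (n + 1)).factorial *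
          (1 + ‖y‖) ^ (-((k + (n + 1) : ℕ) : ℝ))) := by
        gcongr
        exact exp_neg_sq_half_le _ (norm_nonneg y)
    _ = Real.exp (3 / 2) * (k + (n + 1)).factorial *
          ((1 + ‖y‖) ^ (k : ℝ) * (1 + ‖y‖) ^ (-((k + (n + 1) : ℕ) : ℝ))) := by
        rw [Real.rpow_natCast]; ring
    _ = _ := by
        rw [← Real.rpow_add h0]; push_cast; ring_nf

lemma integral_exp_neg_sq_pos :
    0 < ∫ z : EuclideanSpace ℝ (Fin n), Real.exp (-(‖z‖ ^ 2 / 2)) := by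
  have hi : Integrable fun z : EuclideanSpace ℝ (Fin n) => Real.exp (-(‖z‖ ^ 2 / 2)) := by
    simpa using integrable_exp_moment (n := n) 0
  exact integral_exp_pos hi

lemma gaussWeight_pos (y : EuclideanSpace ℝ (Fin n)) : 0 < gaussWeight y :=
  mul_pos (inv_pos.2 integral_exp_neg_sq_pos) (Real.exp_pos _)

lemma gaussWeight_le (y : EuclideanSpace ℝ (Fin n)) :
    gaussWeight y ≤ gaussWeight (0 : EuclideanSpace ℝ (Fin n)) := by
  unfold gaussWeight
  refine mul_le_mul_of_nonneg_left (Real.exp_le_exp.2 ?_) (inv_pos.2 integral_exp_neg_sq_pos).le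
  simp only [norm_zero]
  have := sq_nonneg ‖y‖
  linarith

lemma continuous_gaussWeight : Continuous (gaussWeight (n := n)) := by
  unfold gaussWeight
  fun_prop

lemma integrable_gaussWeight_moment (k : ℕ) :
    Integrable fun y : EuclideanSpace ℝ (Fin n) => (1 + ‖y‖) ^ k * gaussWeight y := by
  refine ((integrable_exp_moment (n := n) k).const_mul
    (∫ z : EuclideanSpace ℝ (Fin n), Real.exp (-(‖z‖ ^ 2 / 2)))⁻¹).congr
    (Filter.Eventually.of_forall fun y => ?_)
  simp only [gaussWeight]; ring

lemma integrable_gaussWeight : Integrable (gaussWeight (n := n)) := by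
  simpa using integrable_gaussWeight_moment (n := n) 0

lemma integral_gaussWeight : ∫ y : EuclideanSpace ℝ (Fin n), gaussWeight y = 1 := by
  simp only [gaussWeight]
  rw [integral_const_mul]
  exact inv_mul_cancel₀ integral_exp_neg_sq_pos.ne'

lemma hasFDerivAt_gaussWeight (y : EuclideanSpace ℝ (Fin n)) :
    HasFDerivAt gaussWeight (-(gaussWeight y) • innerSL ℝ y) y := by
  have h1 : HasFDerivAt (fun z : EuclideanSpace ℝ (Fin n) => ‖z‖ ^ 2) (2 • innerSL ℝ y) y :=
    (hasStrictFDerivAt_norm_sq y).hasFDerivAt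
  have h2 := (((h1.mul_const (1 / 2 : ℝ)).neg).exp).const_mul
    (∫ z : EuclideanSpace ℝ (Fin n), Real.exp (-(‖z‖ ^ 2 / 2)))⁻¹
  refine (h2.congr_of_eventuallyEq (Filter.Eventually.of_forall fun z => ?_)).congr_fderiv ?_
  · simp [gaussWeight, div_eq_mul_inv]
  · ext z
    simp [gaussWeight, div_eq_mul_inv]
    ring

lemma hasLineDerivAt_gaussWeight (i : Fin n) (y : EuclideanSpace ℝ (Fin n)) :
    HasLineDerivAt ℝ gaussWeight (-(y i * gaussWeight y)) y (EuclideanSpace.single i 1) := by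
  have := (hasFDerivAt_gaussWeight y).hasLineDerivAt (EuclideanSpace.single i 1)
  have hv : (-(gaussWeight y) • innerSL ℝ y) (EuclideanSpace.single i (1 : ℝ)) =
      -(y i * gaussWeight y) := by
    simp [EuclideanSpace.inner_single_right]
    ring
  rw [hv] at this
  exact this

end Gauss

/-- The Gaussian average `x ↦ E h(x + sZ)`, that is, the heat semigroup at time `s² / 2`. -/
noncomputable def heat {n : ℕ} (h : EuclideanSpace ℝ (Fin n) → ℝ) (s : ℝ)
    (x : EuclideanSpace ℝ (Fin n)) : ℝ :=
  ∫ y, gaussWeight y * h (x + s • y)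

/-- The integrable majorant `(1 + |x|)^{-(n+1)}`. -/
noncomputable def decay {n : ℕ} (x : EuclideanSpace ℝ (Fin n)) : ℝ :=
  (1 + ‖x‖) ^ (-((n : ℝ) + 1))

section Heat

variable {n : ℕ} {h : EuclideanSpace ℝ (Fin n) → ℝ}

lemma integrable_decay : Integrable (decay (n := n)) :=
  integrable_one_add_norm (by simp)

lemma decay_pos (x : EuclideanSpace ℝ (Fin n)) : 0 < decay x := by
  unfold decay; positivity

lemma decay_le_one (x : EuclideanSpace ℝ (Fin n)) : decay x ≤ 1 :=
  Real.rpow_le_one_of_one_le_of_nonpos (by linarith [norm_nonneg x])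
    (by linarith [n.cast_nonneg (α := ℝ)])

lemma heat_zero (h : EuclideanSpace ℝ (Fin n) → ℝ) : heat h 0 = h := by
  funext x
  simp [heat, integral_mul_const, integral_gaussWeight]

lemma IsTestFun.integrable_heat_aux (hh : IsTestFun h) (s : ℝ) (x : EuclideanSpace ℝ (Fin n)) :
    Integrable fun y => gaussWeight y * h (x + s • y) := by
  obtain ⟨M, _, hM⟩ := hh.exists_bound
  have := hh.continuous
  exact integrable_gaussWeight.mul_bdd (c := M) (by fun_prop)
    (Filter.Eventually.of_forall fun y => hM _)

lemma continuous_heat (hh : IsTestFun h) (s : ℝ) : Continuous (heat h s) := by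
  obtain ⟨M, _, hM⟩ := hh.exists_bound
  have hc := hh.continuous
  have hg := continuous_gaussWeight (n := n)
  refine continuous_of_dominated (bound := fun y => gaussWeight y * M)
    (fun x => ?_) (fun x => ?_) (integrable_gaussWeight.mul_const M) ?_
  · exact (hh.integrable_heat_aux s x).aestronglyMeasurable
  · refine Filter.Eventually.of_forall fun y => ?_
    rw [norm_mul, Real.norm_of_nonneg (gaussWeight_pos y).le]
    exact mul_le_mul_of_nonneg_left (hM _) (gaussWeight_pos y).le
  · refine Filter.Eventually.of_forall fun y => ?_
    fun_prop

lemma hasLineDerivAt_heat (hh : IsTestFun h) (s : ℝ) (i : Fin n) (x : EuclideanSpace ℝ (Fin n)) :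
    HasLineDerivAt ℝ (heat h s) (heat (partialDeriv' i h) s x) x (EuclideanSpace.single i 1) := by
  have hh' := hh.partialDeriv' i
  obtain ⟨M, _, hM⟩ := hh'.exists_bound
  have key := hasDerivAt_integral_of_dominated_loc_of_deriv_le (μ := volume) (x₀ := (0 : ℝ))
    (s := Set.univ) (bound := fun y => gaussWeight y * M)
    (F := fun t y => gaussWeight y * h (x + t • EuclideanSpace.single i (1 : ℝ) + s • y))
    (F' := fun t y => gaussWeight y *
      partialDeriv' i h (x + t • EuclideanSpace.single i (1 : ℝ) + s • y)) Filter.univ_mem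
    (Filter.Eventually.of_forall fun t => (hh.integrable_heat_aux s _).aestronglyMeasurable)
    (hh.integrable_heat_aux s _) (hh'.integrable_heat_aux s _).aestronglyMeasurable
    (Filter.Eventually.of_forall fun y t _ => ?_) (integrable_gaussWeight.mul_const M)
    (Filter.Eventually.of_forall fun y t _ => ?_)
  · have := key.2
    simp only [zero_smul, add_zero] at this
    exact this
  · rw [norm_mul, Real.norm_of_nonneg (gaussWeight_pos y).le]
    exact mul_le_mul_of_nonneg_left (hM _) (gaussWeight_pos y).le
  · refine HasDerivAt.const_mul _ ?_
    have h1 : HasDerivAt (fun t : ℝ => x + t • EuclideanSpace.single i (1 : ℝ) + s • y)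
        (EuclideanSpace.single i (1 : ℝ)) t := by
      simpa using (((hasDerivAt_id t).smul_const (EuclideanSpace.single i (1 : ℝ))).const_add
        x).add_const (s • y)
    exact (hh.differentiable _).hasFDerivAt.comp_hasDerivAt t h1

lemma integrable_coord_gaussWeight (i : Fin n) :
    Integrable fun y : EuclideanSpace ℝ (Fin n) => y i * gaussWeight y := by
  have hg := continuous_gaussWeight (n := n)
  refine (integrable_gaussWeight_moment (n := n) 1).mono' (by fun_prop)
    (Filter.Eventually.of_forall fun y => ?_)
  rw [norm_mul, Real.norm_of_nonneg (gaussWeight_pos y).le, pow_one]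
  refine mul_le_mul_of_nonneg_right ?_ (gaussWeight_pos y).le
  linarith [PiLp.norm_apply_le y i]

/-- Gaussian integration by parts. -/
lemma integral_coord_gaussWeight_mul (hh : IsTestFun h) (s : ℝ) (i : Fin n)
    (x : EuclideanSpace ℝ (Fin n)) :
    ∫ y, y i * gaussWeight y * h (x + s • y) = s * heat (partialDeriv' i h) s x := by
  have hh' := hh.partialDeriv' i
  obtain ⟨M, _, hM⟩ := hh.exists_bound
  have hc := hh.continuous
  have hI := (integrable_coord_gaussWeight i).mul_bdd (c := M) (g := fun y => h (x + s • y))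
    (by fun_prop) (Filter.Eventually.of_forall fun y => hM _)
  have key := integral_bilinear_hasLineDerivAt_right_eq_neg_left_of_integrable (μ := volume)
    (f := fun y : EuclideanSpace ℝ (Fin n) => h (x + s • y)) (g := gaussWeight)
    (f' := fun y => s * partialDeriv' i h (x + s • y))
    (g' := fun y => -(y i * gaussWeight y)) (v := EuclideanSpace.single i (1 : ℝ))
    (B := ContinuousLinearMap.mul ℝ ℝ) ?_ ?_ ?_ ?_ ?_
  · simp only [ContinuousLinearMap.mul_apply'] at key
    calc ∫ y, y i * gaussWeight y * h (x + s • y)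
        = -∫ y, h (x + s • y) * -(y i * gaussWeight y) := by
          rw [← integral_neg]; congr 1; funext y; ring
      _ = s * heat (partialDeriv' i h) s x := by
          rw [key, neg_neg, heat, ← integral_const_mul]; congr 1; funext y; ring
  · refine ((hh'.integrable_heat_aux s x).const_mul s).congr
      (Filter.Eventually.of_forall fun y => ?_)
    simp only [ContinuousLinearMap.mul_apply']; ring
  · refine hI.neg.congr (Filter.Eventually.of_forall fun y => ?_)
    simp only [ContinuousLinearMap.mul_apply', Pi.neg_apply]; ring
  · refine (hh.integrable_heat_aux s x).congr (Filter.Eventually.of_forall fun y => ?_)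
    simp only [ContinuousLinearMap.mul_apply']; ring
  · intro y _
    have h1 : HasDerivAt (fun t : ℝ => x + s • (y + t • EuclideanSpace.single i (1 : ℝ)))
        (s • EuclideanSpace.single i (1 : ℝ)) 0 := by
      simpa using ((((hasDerivAt_id (0 : ℝ)).smul_const
        (EuclideanSpace.single i (1 : ℝ))).const_add y).const_smul s).const_add x
    have h2 := (hh.differentiable
      (x + s • (y + (0 : ℝ) • EuclideanSpace.single i (1 : ℝ)))).hasFDerivAt.comp_hasDerivAt 0 h1
    rw [map_smul, zero_smul, add_zero] at h2
    exact h2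
  · exact fun y _ => hasLineDerivAt_gaussWeight i y

lemma fderiv_apply_eq_sum (h : EuclideanSpace ℝ (Fin n) → ℝ) (x y : EuclideanSpace ℝ (Fin n)) :
    fderiv ℝ h x y = ∑ i, y i * partialDeriv' i h x := by
  conv_lhs => rw [← (EuclideanSpace.basisFun (Fin n) ℝ).sum_repr y]
  simp [partialDeriv']

/-- The heat equation. -/
lemma hasDerivAt_heat (hh : IsTestFun h) (s : ℝ) (x : EuclideanSpace ℝ (Fin n)) :
    HasDerivAt (fun s => heat h s x) (s * heat (lap h) s x) s := by
  have hMi : ∀ i : Fin n, ∃ M, 0 ≤ M ∧ ∀ x, |partialDeriv' i h x| ≤ M :=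
    fun i => (hh.partialDeriv' i).exists_bound
  choose M hM0 hM using hMi
  have hint : ∀ (i : Fin n) (s : ℝ), Integrable fun y : EuclideanSpace ℝ (Fin n) =>
      y i * gaussWeight y * partialDeriv' i h (x + s • y) := fun i s => by
    have hc := (hh.partialDeriv' i).continuous
    exact (integrable_coord_gaussWeight i).mul_bdd (c := M i) (by fun_prop)
      (Filter.Eventually.of_forall fun y => hM i _)
  have hB : Integrable fun y : EuclideanSpace ℝ (Fin n) => ∑ i, |y i * gaussWeight y| * M i :=
    integrable_finsetSum _ fun i _ => (integrable_coord_gaussWeight i).abs.mul_const _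
  have key := hasDerivAt_integral_of_dominated_loc_of_deriv_le (μ := volume) (x₀ := s)
    (s := Set.univ) (bound := fun y => ∑ i, |y i * gaussWeight y| * M i)
    (F := fun s y => gaussWeight y * h (x + s • y))
    (F' := fun s y => ∑ i, y i * gaussWeight y * partialDeriv' i h (x + s • y)) Filter.univ_mem
    (Filter.Eventually.of_forall fun t => (hh.integrable_heat_aux t x).aestronglyMeasurable)
    (hh.integrable_heat_aux s x)
    (integrable_finsetSum _ fun i _ => hint i s).aestronglyMeasurable
    (Filter.Eventually.of_forall fun y t _ => ?_) hB
    (Filter.Eventually.of_forall fun y t _ => ?_)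
  · have h2 := key.2
    rw [integral_finsetSum _ fun i _ => hint i s] at h2
    simp only [integral_coord_gaussWeight_mul (hh.partialDeriv' _)] at h2
    have h3 : s * heat (lap h) s x =
        ∑ i, s * heat (partialDeriv' i (partialDeriv' i h)) s x := by
      rw [← Finset.mul_sum]
      congr 1
      simp only [heat, lap, Finset.mul_sum]
      exact integral_finsetSum _ fun i _ => (hh.hessEntry i i).integrable_heat_aux s x
    rw [h3]
    exact h2
  · refine (norm_sum_le _ _).trans (Finset.sum_le_sum fun i _ => ?_)
    rw [norm_mul]
    exact mul_le_mul_of_nonneg_left (hM i _) (norm_nonneg _)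
  · have h1 : HasDerivAt (fun t : ℝ => x + t • y) y t := by
      simpa using ((hasDerivAt_id t).smul_const y).const_add x
    have h2 := ((hh.differentiable (x + t • y)).hasFDerivAt.comp_hasDerivAt t h1).const_mul
      (gaussWeight y)
    rw [fderiv_apply_eq_sum h] at h2
    have h3 : gaussWeight y * ∑ i, y i * partialDeriv' i h (x + t • y) =
        ∑ i, y i * gaussWeight y * partialDeriv' i h (x + t • y) := by
      rw [Finset.mul_sum]
      exact Finset.sum_congr rfl fun i _ => by ring
    rw [h3] at h2
    exact h2

lemma exists_heat_le_decay (hh : IsTestFun h) (S : ℝ) :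
    ∃ C, 0 ≤ C ∧ ∀ s, |s| ≤ S → ∀ x, |heat h s x| ≤ C * decay x := by
  obtain ⟨M, hM0, hM⟩ := hh.exists_bound
  obtain ⟨R, hR0, hR⟩ := hh.exists_support_bound
  set J := ∫ y : EuclideanSpace ℝ (Fin n), (1 + ‖y‖) ^ (n + 1) * gaussWeight y with hJ
  have hJ0 : 0 ≤ J := integral_nonneg fun y => by have := gaussWeight_pos y; positivity
  rcases lt_or_ge S 0 with hS | hS
  · exact ⟨0, le_rfl, fun s hs => absurd (abs_nonneg s) (by linarith)⟩
  refine ⟨M * (1 + R + S) ^ (n + 1) * J, by positivity, fun s hs x => ?_⟩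
  have hx : 0 < 1 + ‖x‖ := by positivity
  have hdec : decay x = ((1 + ‖x‖) ^ (n + 1))⁻¹ := by
    rw [decay, Real.rpow_neg hx.le, ← Nat.cast_add_one, Real.rpow_natCast]
  have hpt : ∀ y, ‖gaussWeight y * h (x + s • y)‖ ≤
      M * (1 + R + S) ^ (n + 1) * decay x * ((1 + ‖y‖) ^ (n + 1) * gaussWeight y) := by
    intro y
    have hg := gaussWeight_pos y
    have hdx := decay_pos x
    rw [norm_mul, Real.norm_of_nonneg hg.le]
    by_cases hy : R < ‖x + s • y‖
    · rw [hR _ hy]; simp; positivity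
    · have hxn : ‖x‖ ≤ R + S * ‖y‖ := by
        calc ‖x‖ = ‖(x + s • y) - s • y‖ := by simp
          _ ≤ ‖x + s • y‖ + ‖s • y‖ := norm_sub_le _ _
          _ ≤ R + S * ‖y‖ := by
            rw [norm_smul, Real.norm_eq_abs]
            gcongr
            exact not_lt.1 hy
      have h1 : 1 + ‖x‖ ≤ (1 + R + S) * (1 + ‖y‖) := by
        nlinarith [norm_nonneg y, mul_nonneg hR0 (norm_nonneg y)]
      have h2 : 1 ≤ ((1 + R + S) * (1 + ‖y‖)) ^ (n + 1) * decay x := by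
        rw [hdec, ← div_eq_mul_inv, one_le_div (by positivity)]
        gcongr
      have h3 : ‖h (x + s • y)‖ ≤ M * (((1 + R + S) * (1 + ‖y‖)) ^ (n + 1) * decay x) :=
        (hM _).trans (le_mul_of_one_le_right hM0 h2)
      calc gaussWeight y * ‖h (x + s • y)‖
          ≤ gaussWeight y * (M * (((1 + R + S) * (1 + ‖y‖)) ^ (n + 1) * decay x)) := by gcongr
        _ = _ := by rw [mul_pow]; ring
  have := norm_integral_le_of_norm_le
    ((integrable_gaussWeight_moment (n := n) (n + 1)).const_mul
      (M * (1 + R + S) ^ (n + 1) * decay x)) (Filter.Eventually.of_forall hpt)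
  rw [integral_const_mul, ← hJ] at this
  calc |heat h s x| ≤ _ := this
    _ = _ := by ring

lemma integrable_heat (hh : IsTestFun h) (s : ℝ) : Integrable (heat h s) := by
  obtain ⟨C, _, hC⟩ := exists_heat_le_decay hh |s|
  exact (integrable_decay.const_mul C).mono' (continuous_heat hh s).aestronglyMeasurable
    (Filter.Eventually.of_forall fun x => hC s le_rfl x)

lemma abs_heat_le (hh : IsTestFun h) {s : ℝ} (hs : 0 < s) (x : EuclideanSpace ℝ (Fin n)) :
    |heat h s x| ≤
      gaussWeight (0 : EuclideanSpace ℝ (Fin n)) * (∫ z, |h z|) * (s ^ n)⁻¹ := by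
  have hi : Integrable fun y => |h (x + s • y)| :=
    ((hh.integrable.comp_add_left x).comp_smul hs.ne').abs
  have h1 := norm_integral_le_of_norm_le (f := fun y => gaussWeight y * h (x + s • y))
    (hi.const_mul (gaussWeight (0 : EuclideanSpace ℝ (Fin n))))
    (Filter.Eventually.of_forall fun y => by
      rw [norm_mul, Real.norm_of_nonneg (gaussWeight_pos y).le]
      exact mul_le_mul_of_nonneg_right (gaussWeight_le y) (norm_nonneg _))
  rw [integral_const_mul, Measure.integral_comp_smul_of_nonneg volume
    (fun z => |h (x + z)|) s (hR := hs.le), integral_add_left_eq_self (fun z => |h z|) x] at h1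
  simp only [finrank_euclideanSpace, Fintype.card_fin, smul_eq_mul] at h1
  calc |heat h s x| ≤ _ := h1
    _ = _ := by ring

lemma integral_abs_heat_le (hh : IsTestFun h) (s : ℝ) :
    ∫ x, |heat h s x| ≤ ∫ x, |h x| := by
  have hg := continuous_gaussWeight (n := n)
  have hc := hh.continuous
  have h1 : ∀ x, ‖heat h s x‖ₑ ≤ ∫⁻ y, ‖gaussWeight y‖ₑ * ‖h (x + s • y)‖ₑ := fun x => by
    refine (enorm_integral_le_lintegral_enorm _).trans_eq (lintegral_congr fun y => ?_)
    rw [enorm_mul]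
  have h2 : ∫⁻ x, ‖heat h s x‖ₑ ≤ ∫⁻ x, ‖h x‖ₑ := by
    calc ∫⁻ x, ‖heat h s x‖ₑ
        ≤ ∫⁻ x, ∫⁻ y, ‖gaussWeight y‖ₑ * ‖h (x + s • y)‖ₑ := lintegral_mono h1
      _ = ∫⁻ y, ∫⁻ x, ‖gaussWeight y‖ₑ * ‖h (x + s • y)‖ₑ :=
          lintegral_lintegral_swap (by fun_prop)
      _ = ∫⁻ y, ‖gaussWeight (n := n) y‖ₑ * ∫⁻ x, ‖h x‖ₑ := by
          refine lintegral_congr fun y => ?_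
          rw [lintegral_const_mul _ (Continuous.measurable (by fun_prop)),
            lintegral_add_right_eq_self (fun x => ‖h x‖ₑ)]
      _ = (∫⁻ y, ‖gaussWeight (n := n) y‖ₑ) * ∫⁻ x, ‖h x‖ₑ :=
          lintegral_mul_const _ (by fun_prop)
      _ = ∫⁻ x, ‖h x‖ₑ := by
          rw [← ofReal_integral_norm_eq_lintegral_enorm integrable_gaussWeight]
          simp only [Real.norm_of_nonneg (gaussWeight_pos _).le, integral_gaussWeight]
          simp
  rw [← ofReal_integral_norm_eq_lintegral_enorm (integrable_heat hh s),
    ← ofReal_integral_norm_eq_lintegral_enorm hh.integrable,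
    ENNReal.ofReal_le_ofReal_iff (integral_nonneg fun x => norm_nonneg _)] at h2
  exact h2

end Heat

section Bellman

lemma hasDerivAt_abs_rpow_mul {r : ℝ} (hr : 0 < r) (x : ℝ) :
    HasDerivAt (fun x : ℝ => |x| ^ r * x) ((r + 1) * |x| ^ r) x := by
  rcases eq_or_ne x 0 with rfl | hx
  · rw [hasDerivAt_iff_tendsto_slope]
    have h1 : Filter.Tendsto (fun x : ℝ => |x| ^ r) (nhdsWithin 0 {0}ᶜ) (nhds 0) := by
      have : Continuous fun x : ℝ => |x| ^ r := continuous_abs.rpow_const fun _ => Or.inr hr.le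
      have h2 := this.tendsto 0
      rw [abs_zero, Real.zero_rpow hr.ne'] at h2
      exact h2.mono_left nhdsWithin_le_nhds
    rw [abs_zero, Real.zero_rpow hr.ne', mul_zero]
    refine h1.congr' ?_
    filter_upwards [self_mem_nhdsWithin] with y hy
    have hy : y ≠ 0 := hy
    simp [slope_def_field, hy]
  · have h1 := ((hasDerivAt_abs hx).rpow_const (p := r) (Or.inl (abs_ne_zero.2 hx))).mul
      (hasDerivAt_id x)
    refine h1.congr_deriv ?_
    have h2 : |x| ^ r = |x| ^ (r - 1) * |x| := by
      rw [← Real.rpow_add_one (abs_ne_zero.2 hx)]; ring_nf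
    have h3 : (SignType.sign x : ℝ) * x = |x| := sign_mul_self x
    simp only [id]
    rw [h2]
    linear_combination r * |x| ^ (r - 1) * h3

/-- The Bellman function `K ((u²+ε²)^{p/2} - ε^p) + |v|^q + √(P^p + P v²) - ε^p`,
where `P = u² + ε²` and `K = 5 / (p (p - 1))`. -/
noncomputable def bell (p q ε u v : ℝ) : ℝ :=
  5 / (p * (p - 1)) * ((u ^ 2 + ε ^ 2) ^ (p / 2) - (ε ^ 2) ^ (p / 2)) + |v| ^ q +
    (√((u ^ 2 + ε ^ 2) * ((u ^ 2 + ε ^ 2) ^ (p - 1) + v ^ 2)) - (ε ^ 2) ^ (p / 2))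

/-- The `u`-derivative of `bell`. -/
noncomputable def bellU (p ε u v : ℝ) : ℝ :=
  5 / (p * (p - 1)) * (p * u * (u ^ 2 + ε ^ 2) ^ (p / 2 - 1)) +
    u * (p * (u ^ 2 + ε ^ 2) ^ (p - 1) + v ^ 2) /
      √((u ^ 2 + ε ^ 2) * ((u ^ 2 + ε ^ 2) ^ (p - 1) + v ^ 2))

/-- The `v`-derivative of `bell`. -/
noncomputable def bellV (p q ε u v : ℝ) : ℝ :=
  q * (|v| ^ (q - 2) * v) +
    (u ^ 2 + ε ^ 2) * v / √((u ^ 2 + ε ^ 2) * ((u ^ 2 + ε ^ 2) ^ (p - 1) + v ^ 2))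

/-- The second `u`-derivative of `bell`. -/
noncomputable def bellUU (p ε u v : ℝ) : ℝ :=
  5 / (p * (p - 1)) * (p * (u ^ 2 + ε ^ 2) ^ (p / 2 - 1) +
      p * (p - 2) * u ^ 2 * (u ^ 2 + ε ^ 2) ^ (p / 2 - 2)) +
    ((p * (u ^ 2 + ε ^ 2) ^ (p - 1) + v ^ 2 +
        2 * p * (p - 1) * u ^ 2 * (u ^ 2 + ε ^ 2) ^ (p - 2)) /
        √((u ^ 2 + ε ^ 2) * ((u ^ 2 + ε ^ 2) ^ (p - 1) + v ^ 2)) -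
      u ^ 2 * (p * (u ^ 2 + ε ^ 2) ^ (p - 1) + v ^ 2) ^ 2 /
        √((u ^ 2 + ε ^ 2) * ((u ^ 2 + ε ^ 2) ^ (p - 1) + v ^ 2)) ^ 3)

/-- The mixed second derivative of `bell`. -/
noncomputable def bellUV (p ε u v : ℝ) : ℝ :=
  2 * u * v / √((u ^ 2 + ε ^ 2) * ((u ^ 2 + ε ^ 2) ^ (p - 1) + v ^ 2)) -
    u * v * (u ^ 2 + ε ^ 2) * (p * (u ^ 2 + ε ^ 2) ^ (p - 1) + v ^ 2) /
      √((u ^ 2 + ε ^ 2) * ((u ^ 2 + ε ^ 2) ^ (p - 1) + v ^ 2)) ^ 3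

/-- The second `v`-derivative of `bell`. -/
noncomputable def bellVV (p q ε u v : ℝ) : ℝ :=
  q * ((q - 1) * |v| ^ (q - 2)) +
    ((u ^ 2 + ε ^ 2) / √((u ^ 2 + ε ^ 2) * ((u ^ 2 + ε ^ 2) ^ (p - 1) + v ^ 2)) -
      (u ^ 2 + ε ^ 2) ^ 2 * v ^ 2 /
        √((u ^ 2 + ε ^ 2) * ((u ^ 2 + ε ^ 2) ^ (p - 1) + v ^ 2)) ^ 3)

variable {p q ε : ℝ}

lemma sq_add_sq_pos_of_pos (hε : 0 < ε) (u : ℝ) : 0 < u ^ 2 + ε ^ 2 := by positivity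

lemma bell_radicand_pos (hε : 0 < ε) (u v : ℝ) :
    0 < (u ^ 2 + ε ^ 2) * ((u ^ 2 + ε ^ 2) ^ (p - 1) + v ^ 2) := by positivity

section Deriv

variable {f g : ℝ → ℝ} {f' g' t : ℝ}

lemma hasDerivAt_sq_add (hf : HasDerivAt f f' t) (c : ℝ) :
    HasDerivAt (fun t => f t ^ 2 + c) (2 * f t * f') t := by
  simpa using (hf.pow 2).add_const c

lemma hasDerivAt_sq_add_rpow (hε : 0 < ε) (hf : HasDerivAt f f' t) (r : ℝ) :
    HasDerivAt (fun t => (f t ^ 2 + ε ^ 2) ^ r)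
      (2 * f t * f' * r * (f t ^ 2 + ε ^ 2) ^ (r - 1)) t :=
  (hasDerivAt_sq_add hf (ε ^ 2)).rpow_const (Or.inl (sq_add_sq_pos_of_pos hε _).ne')

lemma hasDerivAt_bell_sqrt (hε : 0 < ε) (hf : HasDerivAt f f' t) (hg : HasDerivAt g g' t) :
    HasDerivAt (fun t => √((f t ^ 2 + ε ^ 2) * ((f t ^ 2 + ε ^ 2) ^ (p - 1) + g t ^ 2)))
      ((f t * (p * (f t ^ 2 + ε ^ 2) ^ (p - 1) + g t ^ 2) * f' +
        (f t ^ 2 + ε ^ 2) * g t * g') /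
        √((f t ^ 2 + ε ^ 2) * ((f t ^ 2 + ε ^ 2) ^ (p - 1) + g t ^ 2))) t := by
  have hP := sq_add_sq_pos_of_pos hε (f t)
  have hY := bell_radicand_pos (p := p) hε (f t) (g t)
  have h1 := ((hasDerivAt_sq_add hf (ε ^ 2)).mul
    ((hasDerivAt_sq_add_rpow hε hf (p - 1)).add (hg.pow 2))).sqrt hY.ne'
  refine h1.congr_deriv ?_
  have hS := Real.sqrt_pos.2 hY
  have h2 : (f t ^ 2 + ε ^ 2) ^ (p - 1) =
      (f t ^ 2 + ε ^ 2) ^ (p - 1 - 1) * (f t ^ 2 + ε ^ 2) := by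
    rw [← Real.rpow_add_one hP.ne']; ring_nf
  simp only [Pi.mul_apply, Pi.add_apply, Pi.pow_apply]
  rw [div_eq_div_iff (by positivity) (by positivity)]
  push_cast
  linear_combination (-2 * (p - 1) * f t * f' *
    √((f t ^ 2 + ε ^ 2) * ((f t ^ 2 + ε ^ 2) ^ (p - 1) + g t ^ 2))) * h2

lemma hasDerivAt_bell (hq : 2 < q) (hε : 0 < ε)
    (hf : HasDerivAt f f' t) (hg : HasDerivAt g g' t) :
    HasDerivAt (fun t => bell p q ε (f t) (g t))
      (bellU p ε (f t) (g t) * f' + bellV p q ε (f t) (g t) * g') t := by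
  have h1 := ((hasDerivAt_sq_add_rpow hε hf (p / 2)).sub_const ((ε ^ 2) ^ (p / 2))).const_mul
    (5 / (p * (p - 1)))
  have h2 := (hasDerivAt_abs_rpow (g t) (by linarith : 1 < q)).comp t hg
  have h3 := (hasDerivAt_bell_sqrt (p := p) hε hf hg).sub_const ((ε ^ 2) ^ (p / 2))
  refine ((h1.add h2).add h3).congr_deriv ?_
  simp only [bellU, bellV]
  ring

lemma hasDerivAt_bellU (hε : 0 < ε)
    (hf : HasDerivAt f f' t) (hg : HasDerivAt g g' t) :
    HasDerivAt (fun t => bellU p ε (f t) (g t))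
      (bellUU p ε (f t) (g t) * f' + bellUV p ε (f t) (g t) * g') t := by
  have hY := bell_radicand_pos (p := p) hε (f t) (g t)
  have hS := Real.sqrt_pos.2 hY
  have h1 := ((hf.const_mul p).mul (hasDerivAt_sq_add_rpow hε hf (p / 2 - 1))).const_mul
    (5 / (p * (p - 1)))
  have h2 := (hf.mul (((hasDerivAt_sq_add_rpow hε hf (p - 1)).const_mul p).add (hg.pow 2))).div
    (hasDerivAt_bell_sqrt (p := p) hε hf hg) hS.ne'
  refine (h1.add h2).congr_deriv ?_
  simp only [bellUU, bellUV, Pi.mul_apply, Pi.add_apply, Pi.pow_apply]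
  rw [show p / 2 - 1 - 1 = p / 2 - 2 by ring, show p - 1 - 1 = p - 2 by ring]
  generalize √((f t ^ 2 + ε ^ 2) * ((f t ^ 2 + ε ^ 2) ^ (p - 1) + g t ^ 2)) = S at hS
  generalize 5 / (p * (p - 1)) = K
  generalize (f t ^ 2 + ε ^ 2) ^ (p - 1) = w
  generalize (f t ^ 2 + ε ^ 2) ^ (p - 2) = w'
  field_simp
  push_cast
  ring

lemma hasDerivAt_bellV (hq : 2 < q) (hε : 0 < ε)
    (hf : HasDerivAt f f' t) (hg : HasDerivAt g g' t) :
    HasDerivAt (fun t => bellV p q ε (f t) (g t))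
      (bellUV p ε (f t) (g t) * f' + bellVV p q ε (f t) (g t) * g') t := by
  have hY := bell_radicand_pos (p := p) hε (f t) (g t)
  have hS := Real.sqrt_pos.2 hY
  have h1 := (((hasDerivAt_abs_rpow_mul (by linarith : 0 < q - 2) (g t)).comp t hg)).const_mul q
  have h2 := ((hasDerivAt_sq_add hf (ε ^ 2)).mul hg).div
    (hasDerivAt_bell_sqrt (p := p) hε hf hg) hS.ne'
  refine (h1.add h2).congr_deriv ?_
  simp only [bellVV, bellUV, Pi.mul_apply]
  rw [show q - 2 + 1 = q - 1 by ring]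
  generalize √((f t ^ 2 + ε ^ 2) * ((f t ^ 2 + ε ^ 2) ^ (p - 1) + g t ^ 2)) = S at hS
  generalize (f t ^ 2 + ε ^ 2) ^ (p - 1) = w
  field_simp
  ring

end Deriv

section Continuity

lemma continuous_sq_add_rpow (hε : 0 < ε) (r : ℝ) :
    Continuous fun z : ℝ × ℝ => (z.1 ^ 2 + ε ^ 2) ^ r :=
  Continuous.rpow_const (by fun_prop) fun z => Or.inl (sq_add_sq_pos_of_pos hε z.1).ne'

lemma bell_sqrt_ne_zero (hε : 0 < ε) (z : ℝ × ℝ) :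
    √((z.1 ^ 2 + ε ^ 2) * ((z.1 ^ 2 + ε ^ 2) ^ (p - 1) + z.2 ^ 2)) ≠ 0 :=
  (Real.sqrt_pos.2 (bell_radicand_pos hε z.1 z.2)).ne'

lemma continuous_abs_rpow {r : ℝ} (hr : 0 ≤ r) : Continuous fun z : ℝ × ℝ => |z.2| ^ r :=
  Continuous.rpow_const (by fun_prop) fun _ => Or.inr hr

lemma continuous_bell (hq : 2 < q) (hε : 0 < ε) :
    Continuous fun z : ℝ × ℝ => bell p q ε z.1 z.2 := by
  have h1 := continuous_sq_add_rpow hε (p / 2)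
  have h2 := continuous_sq_add_rpow hε (p - 1)
  have h3 := continuous_abs_rpow (by linarith : 0 ≤ q)
  unfold bell
  fun_prop

lemma continuous_bellU (hε : 0 < ε) : Continuous fun z : ℝ × ℝ => bellU p ε z.1 z.2 := by
  have h1 := continuous_sq_add_rpow hε (p / 2 - 1)
  have h2 := continuous_sq_add_rpow hε (p - 1)
  have h4 := bell_sqrt_ne_zero (p := p) hε
  unfold bellU
  fun_prop (disch := exact h4)

lemma continuous_bellV (hq : 2 < q) (hε : 0 < ε) :
    Continuous fun z : ℝ × ℝ => bellV p q ε z.1 z.2 := by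
  have h2 := continuous_sq_add_rpow hε (p - 1)
  have h3 := continuous_abs_rpow (by linarith : 0 ≤ q - 2)
  have h4 := bell_sqrt_ne_zero (p := p) hε
  unfold bellV
  fun_prop (disch := exact h4)

lemma continuous_bellUU (hε : 0 < ε) : Continuous fun z : ℝ × ℝ => bellUU p ε z.1 z.2 := by
  have h1 := continuous_sq_add_rpow hε (p / 2 - 1)
  have h5 := continuous_sq_add_rpow hε (p / 2 - 2)
  have h2 := continuous_sq_add_rpow hε (p - 1)
  have h6 := continuous_sq_add_rpow hε (p - 2)
  have h4 := bell_sqrt_ne_zero (p := p) hε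
  have h7 := fun z => pow_ne_zero 3 (h4 z)
  unfold bellUU
  fun_prop (disch := first | exact h4 | exact h7)

lemma continuous_bellUV (hε : 0 < ε) : Continuous fun z : ℝ × ℝ => bellUV p ε z.1 z.2 := by
  have h2 := continuous_sq_add_rpow hε (p - 1)
  have h4 := bell_sqrt_ne_zero (p := p) hε
  have h7 := fun z => pow_ne_zero 3 (h4 z)
  unfold bellUV
  fun_prop (disch := first | exact h4 | exact h7)

lemma continuous_bellVV (hq : 2 < q) (hε : 0 < ε) :
    Continuous fun z : ℝ × ℝ => bellVV p q ε z.1 z.2 := by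
  have h2 := continuous_sq_add_rpow hε (p - 1)
  have h3 := continuous_abs_rpow (by linarith : 0 ≤ q - 2)
  have h4 := bell_sqrt_ne_zero (p := p) hε
  have h7 := fun z => pow_ne_zero 3 (h4 z)
  unfold bellVV
  fun_prop (disch := first | exact h4 | exact h7)

lemma exists_bound_of_continuous_prod {f : ℝ → ℝ → ℝ}
    (hf : Continuous fun z : ℝ × ℝ => f z.1 z.2) (M : ℝ) :
    ∃ C, 0 ≤ C ∧ ∀ u v, |u| ≤ M → |v| ≤ M → |f u v| ≤ C := by
  obtain ⟨C, hC⟩ := (isCompact_closedBall (0 : ℝ × ℝ) M).exists_bound_of_continuousOn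
    hf.continuousOn
  refine ⟨max C 0, le_max_right _ _, fun u v hu hv => ?_⟩
  refine (hC (u, v) ?_).trans (le_max_left _ _)
  simpa [Prod.norm_def] using ⟨hu, hv⟩

end Continuity

section Bounds

lemma sq_rpow_half (u : ℝ) : (u ^ 2) ^ (p / 2) = |u| ^ p := by
  rw [← sq_abs, ← Real.rpow_natCast, ← Real.rpow_mul (abs_nonneg u)]
  congr 1; push_cast; ring

lemma sqrt_mul_rpow_sub_one {P : ℝ} (hP : 0 < P) : √(P * P ^ (p - 1)) = P ^ (p / 2) := by
  rw [Real.sqrt_eq_rpow, mul_comm, ← Real.rpow_add_one hP.ne', ← Real.rpow_mul hP.le]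
  congr 1; ring

lemma bell_nonneg (hp : 1 < p) (hε : 0 < ε) (u v : ℝ) : 0 ≤ bell p q ε u v := by
  have hP := sq_add_sq_pos_of_pos hε u
  have h1 : (ε ^ 2) ^ (p / 2) ≤ (u ^ 2 + ε ^ 2) ^ (p / 2) :=
    Real.rpow_le_rpow (by positivity) (by nlinarith [sq_nonneg u]) (by linarith)
  have h2 : (u ^ 2 + ε ^ 2) ^ (p / 2) ≤
      √((u ^ 2 + ε ^ 2) * ((u ^ 2 + ε ^ 2) ^ (p - 1) + v ^ 2)) := by
    rw [← sqrt_mul_rpow_sub_one hP]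
    exact Real.sqrt_le_sqrt (mul_le_mul_of_nonneg_left (by nlinarith [sq_nonneg v]) hP.le)
  have h3 : 0 ≤ 5 / (p * (p - 1)) :=
    div_nonneg (by norm_num) (mul_nonneg (by linarith) (by linarith))
  have h4 := mul_nonneg h3 (sub_nonneg.2 h1)
  have h5 := Real.rpow_nonneg (abs_nonneg v) q
  unfold bell
  linarith

lemma bell_le (hp : 1 < p) (hp₂ : p < 2) (hε : 0 < ε) (u v : ℝ) :
    bell p q ε u v ≤ (5 / (p * (p - 1)) + 1) * |u| ^ p + |v| ^ q + |u| * |v| + ε * |v| := by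
  have hP := sq_add_sq_pos_of_pos hε u
  have h1 : (u ^ 2 + ε ^ 2) ^ (p / 2) ≤ |u| ^ p + (ε ^ 2) ^ (p / 2) := by
    rw [← sq_rpow_half u]
    exact Real.rpow_add_le_add_rpow (by positivity) (by positivity) (by linarith) (by linarith)
  have h2 : √((u ^ 2 + ε ^ 2) * ((u ^ 2 + ε ^ 2) ^ (p - 1) + v ^ 2)) ≤
      (u ^ 2 + ε ^ 2) ^ (p / 2) + (|u| + ε) * |v| := by
    have hw : 0 < (u ^ 2 + ε ^ 2) ^ (p - 1) := Real.rpow_pos_of_pos hP _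
    have hs := Real.sqrt_nonneg ((u ^ 2 + ε ^ 2) * (u ^ 2 + ε ^ 2) ^ (p - 1))
    rw [← sqrt_mul_rpow_sub_one hP]
    refine Real.sqrt_le_iff.2 ⟨by positivity, ?_⟩
    have hsq := Real.sq_sqrt (mul_pos hP hw).le
    have h3 : u ^ 2 + ε ^ 2 ≤ (|u| + ε) ^ 2 := by
      nlinarith [sq_abs u, mul_nonneg (abs_nonneg u) hε.le]
    have h4 : (u ^ 2 + ε ^ 2) * v ^ 2 ≤ ((|u| + ε) * |v|) ^ 2 := by
      rw [mul_pow, sq_abs]; exact mul_le_mul_of_nonneg_right h3 (sq_nonneg v)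
    have h5 : 0 ≤ √((u ^ 2 + ε ^ 2) * (u ^ 2 + ε ^ 2) ^ (p - 1)) * ((|u| + ε) * |v|) := by
      positivity
    nlinarith
  have h3 : 0 ≤ 5 / (p * (p - 1)) :=
    div_nonneg (by norm_num) (mul_nonneg (by linarith) (by linarith))
  have h4 := mul_le_mul_of_nonneg_left (sub_le_iff_le_add.2 h1) h3
  unfold bell
  linarith

end Bounds

end Bellman

section Convexity

/-- Quantitative convexity of `√(P^p + P v²)`, in terms of `w = P^{p-1}` and `w' = P^{p-2}`. -/
lemma sqrt_part_uu_nonneg {p u v P w w' S : ℝ} (hp : 1 < p) (hP : 0 < P) (hw : 0 < w)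
    (hS : 0 < S) (hS2 : S ^ 2 = P * (w + v ^ 2)) (huP : u ^ 2 ≤ P) (hw' : P * w' = w) :
    0 ≤ (p * w + v ^ 2 + 2 * p * (p - 1) * u ^ 2 * w') / S -
      u ^ 2 * (p * w + v ^ 2) ^ 2 / S ^ 3 := by
  have hnum : 0 ≤ P * ((p * w + v ^ 2 + 2 * p * (p - 1) * u ^ 2 * w') * (P * (w + v ^ 2)) -
      u ^ 2 * (p * w + v ^ 2) ^ 2) := by
    have h1 : P * ((p * w + v ^ 2 + 2 * p * (p - 1) * u ^ 2 * w') * (P * (w + v ^ 2)) -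
        u ^ 2 * (p * w + v ^ 2) ^ 2) =
        P * ((P - u ^ 2) * ((p * w + v ^ 2) * (w + v ^ 2)) +
          u ^ 2 * ((p - 1) * (p * w ^ 2 + (2 * p - 1) * (w * v ^ 2)))) := by
      rw [← hw']; ring
    rw [h1]
    have h2 : 0 ≤ P - u ^ 2 := by linarith
    have h3 : 0 ≤ p - 1 := by linarith
    have h4 : 0 ≤ 2 * p - 1 := by linarith
    have h5 : 0 ≤ p := by linarith
    positivity
  have h2 := nonneg_of_mul_nonneg_right hnum hP
  rw [← hS2] at h2
  have h3 : (p * w + v ^ 2 + 2 * p * (p - 1) * u ^ 2 * w') / S -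
      u ^ 2 * (p * w + v ^ 2) ^ 2 / S ^ 3 =
      ((p * w + v ^ 2 + 2 * p * (p - 1) * u ^ 2 * w') * S ^ 2 -
        u ^ 2 * (p * w + v ^ 2) ^ 2) / S ^ 3 := by
    field_simp
  rw [h3]
  positivity

lemma abs_sqrt_part_uv_le_one {p u v P w S : ℝ} (hp : 1 < p) (hp₂ : p < 2) (hP : 0 < P)
    (hw : 0 < w) (hS : 0 < S) (hS2 : S ^ 2 = P * (w + v ^ 2)) (huP : u ^ 2 ≤ P) :
    |2 * u * v / S - u * v * P * (p * w + v ^ 2) / S ^ 3| ≤ 1 := by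
  have h1 : 2 * u * v / S - u * v * P * (p * w + v ^ 2) / S ^ 3 =
      (u * v) * (P * ((2 - p) * w + v ^ 2)) / S ^ 3 := by
    have : (u * v) * (P * ((2 - p) * w + v ^ 2)) =
        2 * u * v * S ^ 2 - u * v * P * (p * w + v ^ 2) := by rw [hS2]; ring
    rw [this]
    field_simp
  have h2 : |u * v| ≤ S := by
    refine abs_le_of_sq_le_sq ?_ hS.le
    rw [hS2, mul_pow]
    exact mul_le_mul huP (by linarith) (sq_nonneg v) hP.le
  have h3 : 0 ≤ P * ((2 - p) * w + v ^ 2) := by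
    have : 0 ≤ 2 - p := by linarith
    positivity
  have h4 : P * ((2 - p) * w + v ^ 2) ≤ S ^ 2 := by
    rw [hS2]
    refine mul_le_mul_of_nonneg_left ?_ hP.le
    nlinarith
  rw [h1, abs_div, abs_mul, abs_of_nonneg h3, abs_of_pos (pow_pos hS 3), div_le_one (by positivity)]
  calc |u * v| * (P * ((2 - p) * w + v ^ 2)) ≤ S * S ^ 2 := by gcongr
    _ = S ^ 3 := by ring

lemma sqrt_part_vv_eq {v P w S : ℝ} (hS : 0 < S) (hS2 : S ^ 2 = P * (w + v ^ 2)) :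
    P / S - P ^ 2 * v ^ 2 / S ^ 3 = P ^ 2 * w / S ^ 3 := by
  have : P ^ 2 * w = P * S ^ 2 - P ^ 2 * v ^ 2 := by rw [hS2]; ring
  rw [this]
  field_simp

lemma le_sqrt_part_vv {v r m S : ℝ} (hr : 0 < r) (hm : 0 < m) (hS : 0 < S)
    (hS2 : S ^ 2 = r ^ 2 * (m ^ 2 + v ^ 2)) (hv : v ^ 2 ≤ m ^ 2) :
    0.35 * (r / m) ≤ (r ^ 2) ^ 2 * m ^ 2 / S ^ 3 := by
  have h1 : S ≤ 1.415 * (r * m) := by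
    refine abs_le_of_sq_le_sq' ?_ (by positivity) |>.2
    rw [hS2]
    nlinarith [mul_le_mul_of_nonneg_left hv (sq_nonneg r), sq_nonneg (r * m)]
  have h2 : S ^ 3 ≤ (1.415 * (r * m)) ^ 3 := by gcongr
  rw [le_div_iff₀ (by positivity)]
  calc 0.35 * (r / m) * S ^ 3 ≤ 0.35 * (r / m) * (1.415 * (r * m)) ^ 3 := by gcongr
    _ = (0.35 * 1.415 ^ 3) * ((r ^ 2) ^ 2 * m ^ 2) := by field_simp
    _ ≤ 1 * ((r ^ 2) ^ 2 * m ^ 2) := by gcongr; norm_num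
    _ = _ := one_mul _

/-- The Hessian of the Bellman function dominates `τ a² + τ⁻¹ b²`. -/
lemma exists_le_bell_hess {p q ε : ℝ} (hp : 1 < p) (hp₂ : p < 2) (hpq : (p - 1) * (q - 1) = 1)
    (hq : 2 < q) (hε : 0 < ε) (u v : ℝ) :
    ∃ τ, 0 < τ ∧ ∀ a b : ℝ, τ * a ^ 2 + τ⁻¹ * b ^ 2 ≤
      10 * (bellUU p ε u v * a ^ 2 + 2 * bellUV p ε u v * (a * b) + bellVV p q ε u v * b ^ 2) := by
  have hP := sq_add_sq_pos_of_pos hε u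
  have hY := bell_radicand_pos (p := p) hε u v
  have hS := Real.sqrt_pos.2 hY
  have hS2 := Real.sq_sqrt hY.le
  have huP : u ^ 2 ≤ u ^ 2 + ε ^ 2 := by nlinarith
  set P := u ^ 2 + ε ^ 2 with hPdef
  set S := √(P * (P ^ (p - 1) + v ^ 2)) with hSdef
  have hw : 0 < P ^ (p - 1) := Real.rpow_pos_of_pos hP _
  have hw' : P * P ^ (p - 2) = P ^ (p - 1) := by
    rw [mul_comm, ← Real.rpow_add_one hP.ne']; ring_nf
  have hτ : 0 < P ^ (p / 2 - 1) := Real.rpow_pos_of_pos hP _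
  have hτ' : P * P ^ (p / 2 - 2) = P ^ (p / 2 - 1) := by
    rw [mul_comm, ← Real.rpow_add_one hP.ne']; ring_nf
  have hUU : 5 * P ^ (p / 2 - 1) ≤ bellUU p ε u v := by
    have h1 := sqrt_part_uu_nonneg hp hP hw hS hS2 huP hw'
    have h2 : u ^ 2 * P ^ (p / 2 - 2) ≤ P ^ (p / 2 - 1) := by
      rw [← hτ']
      exact mul_le_mul_of_nonneg_right huP (Real.rpow_pos_of_pos hP _).le
    have h3 : p * (p - 1) * P ^ (p / 2 - 1) ≤
        p * P ^ (p / 2 - 1) + p * (p - 2) * u ^ 2 * P ^ (p / 2 - 2) := by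
      have h4 : 0 ≤ p * (2 - p) := mul_nonneg (by linarith) (by linarith)
      nlinarith [mul_le_mul_of_nonneg_left h2 h4]
    have h5 : 0 < p * (p - 1) := mul_pos (by linarith) (by linarith)
    have h6 : 5 * P ^ (p / 2 - 1) ≤ 5 / (p * (p - 1)) *
        (p * P ^ (p / 2 - 1) + p * (p - 2) * u ^ 2 * P ^ (p / 2 - 2)) := by
      calc 5 * P ^ (p / 2 - 1) = 5 / (p * (p - 1)) * (p * (p - 1) * P ^ (p / 2 - 1)) := by
            rw [← mul_assoc, div_mul_cancel₀ _ h5.ne']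
        _ ≤ _ := by gcongr
    unfold bellUU
    rw [← hPdef, ← hSdef]
    linarith
  have hUV : |bellUV p ε u v| ≤ 1 := by
    unfold bellUV
    rw [← hPdef, ← hSdef]
    exact abs_sqrt_part_uv_le_one hp hp₂ hP hw hS hS2 huP
  have hVV : 0.35 * (P ^ (p / 2 - 1))⁻¹ ≤ bellVV p q ε u v := by
    unfold bellVV
    rw [← hPdef, ← hSdef, sqrt_part_vv_eq hS hS2]
    have h1 : 0 ≤ |v| ^ (q - 2) := Real.rpow_nonneg (abs_nonneg v) _
    have h1' : |v| ^ (q - 2) ≤ q * ((q - 1) * |v| ^ (q - 2)) := by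
      rw [← mul_assoc]
      exact le_mul_of_one_le_left h1 (by nlinarith)
    have hm2 : (P ^ ((p - 1) / 2)) ^ 2 = P ^ (p - 1) := by
      rw [← Real.rpow_natCast, ← Real.rpow_mul hP.le]; congr 1; push_cast; ring
    have hr2 : (√P) ^ 2 = P := Real.sq_sqrt hP.le
    have hm : 0 < P ^ ((p - 1) / 2) := Real.rpow_pos_of_pos hP _
    rcases le_total (v ^ 2) (P ^ (p - 1)) with hv | hv
    · have h2 := le_sqrt_part_vv (Real.sqrt_pos.2 hP) hm hS (by rw [hr2, hm2]; exact hS2)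
        (hv.trans_eq hm2.symm)
      rw [hr2, hm2] at h2
      have h3 : √P / P ^ ((p - 1) / 2) = (P ^ (p / 2 - 1))⁻¹ := by
        rw [Real.sqrt_eq_rpow, ← Real.rpow_sub hP, ← Real.rpow_neg hP.le]; congr 1; ring
      rw [h3] at h2
      linarith
    · have h2 : P ^ ((p - 1) / 2) ≤ |v| := by
        refine abs_le_of_sq_le_sq' ?_ (abs_nonneg v) |>.2
        rw [hm2, sq_abs]; exact hv
      have h3 : (P ^ (p / 2 - 1))⁻¹ ≤ |v| ^ (q - 2) := by
        calc (P ^ (p / 2 - 1))⁻¹ = (P ^ ((p - 1) / 2)) ^ (q - 2) := by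
              rw [← Real.rpow_neg hP.le, ← Real.rpow_mul hP.le]; congr 1
              linear_combination (-1 / 2) * hpq
          _ ≤ _ := by gcongr
      have h4 : 0 ≤ P ^ 2 * P ^ (p - 1) / S ^ 3 := by positivity
      have h5 := inv_pos.2 hτ
      linarith
  refine ⟨P ^ (p / 2 - 1), hτ, fun a b => ?_⟩
  generalize P ^ (p / 2 - 1) = τ at *
  have hti := inv_pos.2 hτ
  have hcross : -(4 * τ * a ^ 2 + τ⁻¹ * b ^ 2 / 4) ≤ 2 * bellUV p ε u v * (a * b) := by
    have h1 : 2 * |a * b| ≤ 4 * τ * a ^ 2 + τ⁻¹ * b ^ 2 / 4 := by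
      have h2 : τ * (2 * a - τ⁻¹ * b / 2) ^ 2 =
          4 * τ * a ^ 2 + τ⁻¹ * b ^ 2 / 4 - 2 * (a * b) := by field_simp; ring
      have h3 : τ * (2 * a + τ⁻¹ * b / 2) ^ 2 =
          4 * τ * a ^ 2 + τ⁻¹ * b ^ 2 / 4 + 2 * (a * b) := by field_simp; ring
      have h4 : 0 ≤ τ * (2 * a - τ⁻¹ * b / 2) ^ 2 := by positivity
      have h5 : 0 ≤ τ * (2 * a + τ⁻¹ * b / 2) ^ 2 := by positivity
      rcases abs_cases (a * b) with h | h <;> linarith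
    have h6 : |bellUV p ε u v * (a * b)| ≤ |a * b| := by
      rw [abs_mul]; exact mul_le_of_le_one_left (abs_nonneg _) hUV
    have h7 := neg_abs_le (bellUV p ε u v * (a * b))
    linarith
  have hA := mul_le_mul_of_nonneg_right hUU (sq_nonneg a)
  have hB := mul_le_mul_of_nonneg_right hVV (sq_nonneg b)
  have hta : 0 ≤ τ * a ^ 2 := by positivity
  have htb : 0 ≤ τ⁻¹ * b ^ 2 := by positivity
  linarith

/-- Summed form: the Bellman Hessian controls products of gradient components. -/
lemma abs_mul_le_sum_bell_hess {p q ε : ℝ} (hp : 1 < p) (hp₂ : p < 2)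
    (hpq : (p - 1) * (q - 1) = 1) (hq : 2 < q) (hε : 0 < ε) (u v : ℝ) {n : ℕ} (a b : Fin n → ℝ)
    (j k : Fin n) :
    2 * |a j * b k| ≤ 10 * ∑ i, (bellUU p ε u v * a i ^ 2 + 2 * bellUV p ε u v * (a i * b i) +
      bellVV p q ε u v * b i ^ 2) := by
  obtain ⟨τ, hτ, h⟩ := exists_le_bell_hess hp hp₂ hpq hq hε u v
  have hti := inv_pos.2 hτ
  rw [Finset.mul_sum]
  refine le_trans ?_ (Finset.sum_le_sum fun i _ => h (a i) (b i))
  rw [Finset.sum_add_distrib]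
  have h1 : τ * a j ^ 2 ≤ ∑ i, τ * a i ^ 2 :=
    Finset.single_le_sum (f := fun i => τ * a i ^ 2) (fun i _ => by positivity) (Finset.mem_univ j)
  have h2 : τ⁻¹ * b k ^ 2 ≤ ∑ i, τ⁻¹ * b i ^ 2 :=
    Finset.single_le_sum (f := fun i => τ⁻¹ * b i ^ 2) (fun i _ => by positivity)
      (Finset.mem_univ k)
  refine le_trans ?_ (add_le_add h1 h2)
  have h3 : τ * (|a j| - τ⁻¹ * |b k|) ^ 2 =
      τ * a j ^ 2 + τ⁻¹ * b k ^ 2 - 2 * |a j * b k| := by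
    rw [abs_mul, ← sq_abs (a j), ← sq_abs (b k)]; field_simp; ring
  have h4 : 0 ≤ τ * (|a j| - τ⁻¹ * |b k|) ^ 2 := by positivity
  linarith

end Convexity

section Flow

variable {n : ℕ} {h f φ : EuclideanSpace ℝ (Fin n) → ℝ}

lemma exists_heat_bound (hh : IsTestFun h) (S : ℝ) :
    ∃ C, 0 ≤ C ∧ ∀ s, |s| ≤ S → ∀ x, |heat h s x| ≤ C := by
  obtain ⟨C, hC0, hC⟩ := exists_heat_le_decay hh S
  exact ⟨C, hC0, fun s hs x =>
    (hC s hs x).trans (mul_le_of_le_one_right hC0 (decay_le_one x))⟩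

lemma integrable_mul_heat {A : EuclideanSpace ℝ (Fin n) → ℝ} (hA : Continuous A)
    (hb : ∃ C, ∀ x, |A x| ≤ C) (hh : IsTestFun h) (s : ℝ) :
    Integrable fun x => A x * heat h s x := by
  obtain ⟨C, hC⟩ := hb
  exact (integrable_heat hh s).bdd_mul (c := C) hA.aestronglyMeasurable
    (Filter.Eventually.of_forall hC)

lemma integral_mul_heat_partialDeriv' {A A' : EuclideanSpace ℝ (Fin n) → ℝ} {i : Fin n}
    (hA : Continuous A) (hb : ∃ C, ∀ x, |A x| ≤ C)
    (hA' : Continuous A') (hb' : ∃ C, ∀ x, |A' x| ≤ C)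
    (hd : ∀ x, HasLineDerivAt ℝ A (A' x) x (EuclideanSpace.single i 1))
    (hh : IsTestFun h) (s : ℝ) :
    ∫ x, A x * heat (partialDeriv' i h) s x = -∫ x, A' x * heat h s x :=
  integral_bilinear_hasLineDerivAt_right_eq_neg_left_of_integrable (μ := volume)
    (B := ContinuousLinearMap.mul ℝ ℝ) (integrable_mul_heat hA' hb' hh s)
    (integrable_mul_heat hA hb (hh.partialDeriv' i) s) (integrable_mul_heat hA hb hh s)
    (fun x _ => hd x) (fun x _ => hasLineDerivAt_heat hh s i x)

lemma hasDerivAt_integral_of_decay {K K' : ℝ → EuclideanSpace ℝ (Fin n) → ℝ} {s : ℝ}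
    (hK : ∀ s, Continuous (K s)) (hKi : Integrable (K s)) (hK' : Continuous (K' s))
    (hd : ∀ s x, HasDerivAt (fun s => K s x) (K' s x) s)
    (hb : ∃ C, ∀ t, |t| ≤ |s| + 1 → ∀ x, |K' t x| ≤ C * decay x) :
    HasDerivAt (fun s => ∫ x, K s x) (∫ x, K' s x) s := by
  obtain ⟨C, hC⟩ := hb
  refine (hasDerivAt_integral_of_dominated_loc_of_deriv_le (μ := volume)
    (s := Metric.ball s 1) (bound := fun x => C * decay x) (Metric.ball_mem_nhds s one_pos)
    (Filter.Eventually.of_forall fun t => (hK t).aestronglyMeasurable) hKi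
    hK'.aestronglyMeasurable (Filter.Eventually.of_forall fun x t ht => hC t ?_ x)
    (integrable_decay.const_mul C) (Filter.Eventually.of_forall fun x t _ => hd t x)).2
  have h1 : |t - s| < 1 := by simpa [Real.dist_eq] using ht
  have h2 := abs_sub_abs_le_abs_sub t s
  linarith

lemma heat_lap (hh : IsTestFun h) (s : ℝ) (x : EuclideanSpace ℝ (Fin n)) :
    heat (lap h) s x = ∑ i, heat (partialDeriv' i (partialDeriv' i h)) s x := by
  simp only [heat, lap, Finset.mul_sum]
  exact integral_finsetSum _ fun i _ => (hh.hessEntry i i).integrable_heat_aux s x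

lemma integral_mul_heat_lap {A : EuclideanSpace ℝ (Fin n) → ℝ}
    {A' : Fin n → EuclideanSpace ℝ (Fin n) → ℝ}
    (hA : Continuous A) (hb : ∃ C, ∀ x, |A x| ≤ C)
    (hA' : ∀ i, Continuous (A' i)) (hb' : ∀ i, ∃ C, ∀ x, |A' i x| ≤ C)
    (hd : ∀ i x, HasLineDerivAt ℝ A (A' i x) x (EuclideanSpace.single i 1))
    (hh : IsTestFun h) (s : ℝ) :
    ∫ x, A x * heat (lap h) s x = -∫ x, ∑ i, A' i x * heat (partialDeriv' i h) s x := by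
  simp only [heat_lap hh, Finset.mul_sum]
  rw [integral_finsetSum _ fun i _ =>
      integrable_mul_heat hA hb ((hh.partialDeriv' i).partialDeriv' i) s,
    integral_finsetSum _ fun i _ => integrable_mul_heat (hA' i) (hb' i) (hh.partialDeriv' i) s,
    ← Finset.sum_neg_distrib]
  exact Finset.sum_congr rfl fun i _ => integral_mul_heat_partialDeriv' hA hb (hA' i) (hb' i)
    (hd i) (hh.partialDeriv' i) s

lemma bounded_heat (hh : IsTestFun h) (s : ℝ) : ∃ C, ∀ x, |heat h s x| ≤ C := by
  obtain ⟨C, _, hC⟩ := exists_heat_bound hh |s|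
  exact ⟨C, hC s le_rfl⟩

/-- Evolution of the pairing between `∂ₖ∂ⱼu` and `φ` along the heat flow. -/
lemma hasDerivAt_integral_hess_mul {u : EuclideanSpace ℝ (Fin n) → ℝ} (hu : IsTestFun u)
    (hφ : IsTestFun φ) (j k : Fin n) (s : ℝ) :
    HasDerivAt (fun s => ∫ x, heat (hessEntry u j k) s x * heat φ s x)
      (-(2 * s * ∫ x, heat (partialDeriv' j (lap u)) s x * heat (partialDeriv' k φ) s x)) s := by
  have hw := hu.hessEntry j k
  have hf := hu.lap
  have hlw : lap (hessEntry u j k) = partialDeriv' k (partialDeriv' j (lap u)) := by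
    rw [hessEntry, (hu.partialDeriv' j).lap_partialDeriv' k, hu.lap_partialDeriv' j]
  have key := hasDerivAt_integral_of_decay (s := s)
    (K := fun s x => heat (hessEntry u j k) s x * heat φ s x)
    (K' := fun s x => s * heat (lap (hessEntry u j k)) s x * heat φ s x +
      heat (hessEntry u j k) s x * (s * heat (lap φ) s x))
    (fun s => (continuous_heat hw s).mul (continuous_heat hφ s))
    (integrable_mul_heat (continuous_heat hw s) (bounded_heat hw s) hφ s)
    (((continuous_heat hw.lap s).const_mul s).mul (continuous_heat hφ s) |>.add
      ((continuous_heat hw s).mul ((continuous_heat hφ.lap s).const_mul s)))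
    (fun s x => (hasDerivAt_heat hw s x).mul (hasDerivAt_heat hφ s x)) ?_
  · refine key.congr_deriv ?_
    have e1 : ∫ x, heat (hessEntry u j k) s x * heat (lap φ) s x =
        ∫ x, heat (lap (hessEntry u j k)) s x * heat φ s x := by
      rw [integral_mul_heat_lap (A' := fun i => heat (partialDeriv' i (hessEntry u j k)) s)
        (continuous_heat hw s) (bounded_heat hw s)
        (fun i => continuous_heat (hw.partialDeriv' i) s)
        (fun i => bounded_heat (hw.partialDeriv' i) s) (fun i x => hasLineDerivAt_heat hw s i x)
        hφ s]
      simp only [mul_comm _ (heat φ s _)]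
      rw [integral_mul_heat_lap (A' := fun i => heat (partialDeriv' i φ) s)
        (continuous_heat hφ s) (bounded_heat hφ s)
        (fun i => continuous_heat (hφ.partialDeriv' i) s)
        (fun i => bounded_heat (hφ.partialDeriv' i) s) (fun i x => hasLineDerivAt_heat hφ s i x)
        hw s]
      simp only [mul_comm]
    have e2 : ∫ x, heat (lap (hessEntry u j k)) s x * heat φ s x =
        -∫ x, heat (partialDeriv' j (lap u)) s x * heat (partialDeriv' k φ) s x := by
      rw [hlw]
      simp only [mul_comm _ (heat φ s _)]
      rw [integral_mul_heat_partialDeriv' (A' := heat (partialDeriv' k φ) s)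
        (continuous_heat hφ s) (bounded_heat hφ s)
        (continuous_heat (hφ.partialDeriv' k) s) (bounded_heat (hφ.partialDeriv' k) s)
        (fun x => hasLineDerivAt_heat hφ s k x) (hf.partialDeriv' j) s]
      simp only [mul_comm]
    have e3 : ∀ x, s * heat (lap (hessEntry u j k)) s x * heat φ s x +
        heat (hessEntry u j k) s x * (s * heat (lap φ) s x) =
        s * (heat (lap (hessEntry u j k)) s x * heat φ s x) +
        s * (heat (hessEntry u j k) s x * heat (lap φ) s x) := fun x => by ring
    simp only [e3]
    rw [integral_add
      ((integrable_mul_heat (continuous_heat hw.lap s) (bounded_heat hw.lap s) hφ s).const_mul s)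
      ((integrable_mul_heat (continuous_heat hw s) (bounded_heat hw s) hφ.lap s).const_mul s),
      integral_const_mul, integral_const_mul, e1, e2]
    ring
  · obtain ⟨C1, h10, h1⟩ := exists_heat_le_decay hw.lap (|s| + 1)
    obtain ⟨C2, h20, h2⟩ := exists_heat_bound hφ (|s| + 1)
    obtain ⟨C3, h30, h3⟩ := exists_heat_bound hw (|s| + 1)
    obtain ⟨C4, h40, h4⟩ := exists_heat_le_decay hφ.lap (|s| + 1)
    refine ⟨(|s| + 1) * C1 * C2 + C3 * ((|s| + 1) * C4), fun t ht x => ?_⟩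
    have hdx := decay_pos x
    calc |t * heat (lap (hessEntry u j k)) t x * heat φ t x +
          heat (hessEntry u j k) t x * (t * heat (lap φ) t x)|
        ≤ |t| * |heat (lap (hessEntry u j k)) t x| * |heat φ t x| +
          |heat (hessEntry u j k) t x| * (|t| * |heat (lap φ) t x|) := by
          refine (abs_add_le _ _).trans_eq ?_
          simp only [abs_mul]
      _ ≤ (|s| + 1) * (C1 * decay x) * C2 + C3 * ((|s| + 1) * (C4 * decay x)) := by
          gcongr
          · exact h1 t ht x
          · exact h2 t ht x
          · exact h3 t ht x
          · exact h4 t ht x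
      _ = _ := by ring

lemma tendsto_integral_hess_mul {w : EuclideanSpace ℝ (Fin n) → ℝ} (hn : 1 ≤ n)
    (hw : IsTestFun w) (hφ : IsTestFun φ) :
    Filter.Tendsto (fun s => ∫ x, heat w s x * heat φ s x) Filter.atTop (nhds 0) := by
  set c := gaussWeight (0 : EuclideanSpace ℝ (Fin n)) * (∫ z, |w z|) with hc
  have hc0 : 0 ≤ c := mul_nonneg (gaussWeight_pos _).le (integral_nonneg fun z => abs_nonneg _)
  have h1 : Filter.Tendsto (fun s : ℝ => c * (s ^ n)⁻¹ * ∫ x, |φ x|) Filter.atTop (nhds 0) := by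
    simpa using ((tendsto_inv_atTop_zero.comp
      (Filter.tendsto_pow_atTop (α := ℝ) (by omega : n ≠ 0))).const_mul c).mul_const (∫ x, |φ x|)
  refine squeeze_zero_norm' ?_ h1
  filter_upwards [Filter.eventually_gt_atTop 0] with s hs
  have hcs : 0 ≤ c * (s ^ n)⁻¹ := by positivity
  calc ‖∫ x, heat w s x * heat φ s x‖ ≤ ∫ x, c * (s ^ n)⁻¹ * |heat φ s x| := by
        refine norm_integral_le_of_norm_le ((integrable_heat hφ s).abs.const_mul _)
          (Filter.Eventually.of_forall fun x => ?_)
        rw [norm_mul]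
        exact mul_le_mul_of_nonneg_right (abs_heat_le hw hs x) (norm_nonneg _)
    _ = c * (s ^ n)⁻¹ * ∫ x, |heat φ s x| := integral_const_mul _ _
    _ ≤ c * (s ^ n)⁻¹ * ∫ x, |φ x| :=
        mul_le_mul_of_nonneg_left (integral_abs_heat_le hφ s) hcs

lemma integrable_abs_heat_rpow (hh : IsTestFun h) (s : ℝ) {r : ℝ} (hr : 1 < r) :
    Integrable fun x => |heat h s x| ^ r := by
  obtain ⟨C, hC⟩ := bounded_heat hh s
  have hc : Continuous fun x => |heat h s x| ^ (r - 1) :=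
    (continuous_heat hh s).abs.rpow_const fun _ => Or.inr (by linarith)
  refine ((integrable_heat hh s).abs.bdd_mul (c := C ^ (r - 1)) hc.aestronglyMeasurable
    (Filter.Eventually.of_forall fun x => ?_)).congr (Filter.Eventually.of_forall fun x => ?_)
  · rw [Real.norm_of_nonneg (Real.rpow_nonneg (abs_nonneg _) _)]
    exact Real.rpow_le_rpow (abs_nonneg _) (hC x) (by linarith)
  · simp only
    rw [← Real.rpow_add_one' (abs_nonneg _) (by linarith)]
    ring_nf

end Flow

section Monotone

variable {n : ℕ} {f φ : EuclideanSpace ℝ (Fin n) → ℝ} {p q ε : ℝ}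

lemma continuous_comp_heat {b : ℝ → ℝ → ℝ} (hb : Continuous fun z : ℝ × ℝ => b z.1 z.2)
    (hf : IsTestFun f) (hφ : IsTestFun φ) (s : ℝ) :
    Continuous fun x => b (heat f s x) (heat φ s x) :=
  hb.comp ((continuous_heat hf s).prodMk (continuous_heat hφ s))

lemma exists_comp_heat_bound {b : ℝ → ℝ → ℝ} (hb : Continuous fun z : ℝ × ℝ => b z.1 z.2)
    (hf : IsTestFun f) (hφ : IsTestFun φ) (S : ℝ) :
    ∃ C, 0 ≤ C ∧ ∀ s, |s| ≤ S → ∀ x, |b (heat f s x) (heat φ s x)| ≤ C := by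
  obtain ⟨C1, _, h1⟩ := exists_heat_bound hf S
  obtain ⟨C2, _, h2⟩ := exists_heat_bound hφ S
  obtain ⟨C, hC0, hC⟩ := exists_bound_of_continuous_prod hb (max C1 C2)
  exact ⟨C, hC0, fun s hs x => hC _ _ ((h1 s hs x).trans (le_max_left _ _))
    ((h2 s hs x).trans (le_max_right _ _))⟩

lemma bounded_comp_heat {b : ℝ → ℝ → ℝ} (hb : Continuous fun z : ℝ × ℝ => b z.1 z.2)
    (hf : IsTestFun f) (hφ : IsTestFun φ) (s : ℝ) :
    ∃ C, ∀ x, |b (heat f s x) (heat φ s x)| ≤ C := by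
  obtain ⟨C, _, hC⟩ := exists_comp_heat_bound hb hf hφ |s|
  exact ⟨C, hC s le_rfl⟩

/-- The majorant of `bell` in `bell_le`, along the heat flow. -/
lemma integrable_bell_majorant (hf : IsTestFun f) (hφ : IsTestFun φ) (hp : 1 < p) (hq : 2 < q)
    (s c : ℝ) :
    Integrable fun x => c * |heat f s x| ^ p + |heat φ s x| ^ q + |heat f s x| * |heat φ s x| +
      ε * |heat φ s x| := by
  have h3 : Integrable fun x => |heat f s x| * |heat φ s x| := by
    simpa only [abs_mul] using
      (integrable_mul_heat (continuous_heat hf s) (bounded_heat hf s) hφ s).abs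
  exact ((((integrable_abs_heat_rpow hf s hp).const_mul c).add
    (integrable_abs_heat_rpow hφ s (by linarith))).add h3).add
    ((integrable_heat hφ s).abs.const_mul ε)

lemma integrable_bell_heat (hf : IsTestFun f) (hφ : IsTestFun φ) (hp : 1 < p) (hp₂ : p < 2)
    (hq : 2 < q) (hε : 0 < ε) (s : ℝ) :
    Integrable fun x => bell p q ε (heat f s x) (heat φ s x) := by
  refine (integrable_bell_majorant hf hφ hp hq s (5 / (p * (p - 1)) + 1) (ε := ε)).mono'
    (continuous_comp_heat (continuous_bell hq hε) hf hφ s).aestronglyMeasurable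
    (Filter.Eventually.of_forall fun x => ?_)
  rw [Real.norm_of_nonneg (bell_nonneg hp hε _ _)]
  exact bell_le hp hp₂ hε _ _

lemma hasLineDerivAt_comp_heat {b bu bv : ℝ → ℝ → ℝ}
    (hb : ∀ (f g : ℝ → ℝ) (f' g' t : ℝ), HasDerivAt f f' t → HasDerivAt g g' t →
      HasDerivAt (fun t => b (f t) (g t)) (bu (f t) (g t) * f' + bv (f t) (g t) * g') t)
    (hf : IsTestFun f) (hφ : IsTestFun φ) (s : ℝ) (i : Fin n) (x : EuclideanSpace ℝ (Fin n)) :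
    HasLineDerivAt ℝ (fun x => b (heat f s x) (heat φ s x))
      (bu (heat f s x) (heat φ s x) * heat (partialDeriv' i f) s x +
        bv (heat f s x) (heat φ s x) * heat (partialDeriv' i φ) s x) x
      (EuclideanSpace.single i 1) := by
  have := hb _ _ _ _ 0 (hasLineDerivAt_heat hf s i x) (hasLineDerivAt_heat hφ s i x)
  simp only [zero_smul, add_zero] at this
  exact this

/-- Integration by parts for `∫ b(F, V) Δh` along the heat flow. -/
lemma integral_comp_heat_mul_heat_lap {b bu bv : ℝ → ℝ → ℝ} {h : EuclideanSpace ℝ (Fin n) → ℝ}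
    (hb : ∀ (f g : ℝ → ℝ) (f' g' t : ℝ), HasDerivAt f f' t → HasDerivAt g g' t →
      HasDerivAt (fun t => b (f t) (g t)) (bu (f t) (g t) * f' + bv (f t) (g t) * g') t)
    (hbc : Continuous fun z : ℝ × ℝ => b z.1 z.2)
    (huc : Continuous fun z : ℝ × ℝ => bu z.1 z.2)
    (hvc : Continuous fun z : ℝ × ℝ => bv z.1 z.2)
    (hf : IsTestFun f) (hφ : IsTestFun φ) (hh : IsTestFun h) (s : ℝ) :
    ∫ x, b (heat f s x) (heat φ s x) * heat (lap h) s x =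
      -∫ x, ∑ i, (bu (heat f s x) (heat φ s x) * heat (partialDeriv' i f) s x +
        bv (heat f s x) (heat φ s x) * heat (partialDeriv' i φ) s x) *
          heat (partialDeriv' i h) s x := by
  refine integral_mul_heat_lap (A' := fun i x => bu (heat f s x) (heat φ s x) *
    heat (partialDeriv' i f) s x + bv (heat f s x) (heat φ s x) * heat (partialDeriv' i φ) s x)
    (continuous_comp_heat hbc hf hφ s) (bounded_comp_heat hbc hf hφ s)
    (fun i => ?_) (fun i => ?_) (fun i x => hasLineDerivAt_comp_heat hb hf hφ s i x) hh s
  · exact ((continuous_comp_heat huc hf hφ s).mul (continuous_heat (hf.partialDeriv' i) s)).add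
      ((continuous_comp_heat hvc hf hφ s).mul (continuous_heat (hφ.partialDeriv' i) s))
  · obtain ⟨C1, h10, h1⟩ := exists_comp_heat_bound huc hf hφ |s|
    obtain ⟨C2, h20, h2⟩ := exists_comp_heat_bound hvc hf hφ |s|
    obtain ⟨C3, h30, h3⟩ := exists_heat_bound (hf.partialDeriv' i) |s|
    obtain ⟨C4, h40, h4⟩ := exists_heat_bound (hφ.partialDeriv' i) |s|
    refine ⟨C1 * C3 + C2 * C4, fun x => (abs_add_le _ _).trans ?_⟩
    rw [abs_mul, abs_mul]
    gcongr
    · exact h1 s le_rfl x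
    · exact h3 s le_rfl x
    · exact h2 s le_rfl x
    · exact h4 s le_rfl x

lemma integrable_comp_heat_mul_mul {b : ℝ → ℝ → ℝ} {h k : EuclideanSpace ℝ (Fin n) → ℝ}
    (hb : Continuous fun z : ℝ × ℝ => b z.1 z.2)
    (hf : IsTestFun f) (hφ : IsTestFun φ) (hh : IsTestFun h) (hk : IsTestFun k) (s : ℝ) :
    Integrable fun x => b (heat f s x) (heat φ s x) * heat h s x * heat k s x := by
  obtain ⟨C1, h10, h1⟩ := exists_comp_heat_bound hb hf hφ |s|
  obtain ⟨C2, h20, h2⟩ := exists_heat_bound hh |s|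
  refine integrable_mul_heat ((continuous_comp_heat hb hf hφ s).mul (continuous_heat hh s))
    ⟨C1 * C2, fun x => ?_⟩ hk s
  rw [Pi.mul_apply, abs_mul]
  exact mul_le_mul (h1 s le_rfl x) (h2 s le_rfl x) (abs_nonneg _) h10

/-- The Hessian form of `bell` along the heat flow. -/
noncomputable def bellForm (p q ε : ℝ) (f φ : EuclideanSpace ℝ (Fin n) → ℝ) (s : ℝ)
    (x : EuclideanSpace ℝ (Fin n)) : ℝ :=
  ∑ i, (bellUU p ε (heat f s x) (heat φ s x) * heat (partialDeriv' i f) s x ^ 2 +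
    2 * bellUV p ε (heat f s x) (heat φ s x) *
      (heat (partialDeriv' i f) s x * heat (partialDeriv' i φ) s x) +
    bellVV p q ε (heat f s x) (heat φ s x) * heat (partialDeriv' i φ) s x ^ 2)

lemma integrable_sum_comp_heat {bu bv : ℝ → ℝ → ℝ} {h : EuclideanSpace ℝ (Fin n) → ℝ}
    (huc : Continuous fun z : ℝ × ℝ => bu z.1 z.2)
    (hvc : Continuous fun z : ℝ × ℝ => bv z.1 z.2)
    (hf : IsTestFun f) (hφ : IsTestFun φ) (hh : IsTestFun h) (s : ℝ) :
    Integrable fun x => ∑ i, (bu (heat f s x) (heat φ s x) * heat (partialDeriv' i f) s x +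
        bv (heat f s x) (heat φ s x) * heat (partialDeriv' i φ) s x) *
          heat (partialDeriv' i h) s x := by
  simp only [add_mul]
  exact integrable_finsetSum _ fun i _ =>
    (integrable_comp_heat_mul_mul huc hf hφ (hf.partialDeriv' i) (hh.partialDeriv' i) s).add
      (integrable_comp_heat_mul_mul hvc hf hφ (hφ.partialDeriv' i) (hh.partialDeriv' i) s)

lemma bellForm_eq (s : ℝ) (x : EuclideanSpace ℝ (Fin n)) :
    bellForm p q ε f φ s x =
      (∑ i, (bellUU p ε (heat f s x) (heat φ s x) * heat (partialDeriv' i f) s x +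
        bellUV p ε (heat f s x) (heat φ s x) * heat (partialDeriv' i φ) s x) *
          heat (partialDeriv' i f) s x) +
      ∑ i, (bellUV p ε (heat f s x) (heat φ s x) * heat (partialDeriv' i f) s x +
        bellVV p q ε (heat f s x) (heat φ s x) * heat (partialDeriv' i φ) s x) *
          heat (partialDeriv' i φ) s x := by
  rw [bellForm, ← Finset.sum_add_distrib]
  exact Finset.sum_congr rfl fun i _ => by ring

lemma integrable_bellForm (hf : IsTestFun f) (hφ : IsTestFun φ) (hq : 2 < q) (hε : 0 < ε)
    (s : ℝ) : Integrable (bellForm p q ε f φ s) := by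
  rw [funext (bellForm_eq (p := p) (q := q) (ε := ε) (f := f) (φ := φ) s)]
  exact (integrable_sum_comp_heat (continuous_bellUU hε) (continuous_bellUV hε) hf hφ hf s).add
    (integrable_sum_comp_heat (continuous_bellUV hε) (continuous_bellVV hq hε) hf hφ hφ s)

lemma hasDerivAt_integral_bell (hf : IsTestFun f) (hφ : IsTestFun φ) (hp : 1 < p) (hp₂ : p < 2)
    (hq : 2 < q) (hε : 0 < ε) (s : ℝ) :
    HasDerivAt (fun s => ∫ x, bell p q ε (heat f s x) (heat φ s x))
      (-(s * ∫ x, bellForm p q ε f φ s x)) s := by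
  have hU := continuous_bellU (p := p) hε
  have hV := continuous_bellV (p := p) hq hε
  have key := hasDerivAt_integral_of_decay (s := s)
    (K := fun s x => bell p q ε (heat f s x) (heat φ s x))
    (K' := fun s x => bellU p ε (heat f s x) (heat φ s x) * (s * heat (lap f) s x) +
      bellV p q ε (heat f s x) (heat φ s x) * (s * heat (lap φ) s x))
    (fun s => continuous_comp_heat (continuous_bell hq hε) hf hφ s)
    (integrable_bell_heat hf hφ hp hp₂ hq hε s)
    (((continuous_comp_heat hU hf hφ s).mul ((continuous_heat hf.lap s).const_mul s)).add
      ((continuous_comp_heat hV hf hφ s).mul ((continuous_heat hφ.lap s).const_mul s)))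
    (fun s x => hasDerivAt_bell hq hε (hasDerivAt_heat hf s x) (hasDerivAt_heat hφ s x)) ?_
  · refine key.congr_deriv ?_
    have e : ∀ x, bellU p ε (heat f s x) (heat φ s x) * (s * heat (lap f) s x) +
        bellV p q ε (heat f s x) (heat φ s x) * (s * heat (lap φ) s x) =
        s * (bellU p ε (heat f s x) (heat φ s x) * heat (lap f) s x) +
        s * (bellV p q ε (heat f s x) (heat φ s x) * heat (lap φ) s x) := fun x => by ring
    simp only [e, bellForm_eq]
    rw [integral_add
      ((integrable_mul_heat (continuous_comp_heat hU hf hφ s) (bounded_comp_heat hU hf hφ s)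
        hf.lap s).const_mul s)
      ((integrable_mul_heat (continuous_comp_heat hV hf hφ s) (bounded_comp_heat hV hf hφ s)
        hφ.lap s).const_mul s), integral_const_mul, integral_const_mul,
      integral_comp_heat_mul_heat_lap (fun f g f' g' t h1 h2 => hasDerivAt_bellU hε h1 h2)
        hU (continuous_bellUU hε) (continuous_bellUV hε) hf hφ hf s,
      integral_comp_heat_mul_heat_lap (fun f g f' g' t h1 h2 => hasDerivAt_bellV hq hε h1 h2)
        hV (continuous_bellUV hε) (continuous_bellVV hq hε) hf hφ hφ s,
      integral_add
        (integrable_sum_comp_heat (continuous_bellUU hε) (continuous_bellUV hε) hf hφ hf s)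
        (integrable_sum_comp_heat (continuous_bellUV hε) (continuous_bellVV hq hε) hf hφ hφ s)]
    ring
  · obtain ⟨C1, h10, h1⟩ := exists_comp_heat_bound hU hf hφ (|s| + 1)
    obtain ⟨C2, h20, h2⟩ := exists_heat_le_decay hf.lap (|s| + 1)
    obtain ⟨C3, h30, h3⟩ := exists_comp_heat_bound hV hf hφ (|s| + 1)
    obtain ⟨C4, h40, h4⟩ := exists_heat_le_decay hφ.lap (|s| + 1)
    refine ⟨C1 * ((|s| + 1) * C2) + C3 * ((|s| + 1) * C4), fun t ht x => ?_⟩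
    have hdx := decay_pos x
    refine (abs_add_le _ _).trans ?_
    simp only [abs_mul]
    calc _ ≤ C1 * ((|s| + 1) * (C2 * decay x)) + C3 * ((|s| + 1) * (C4 * decay x)) := by
          gcongr
          · exact h1 t ht x
          · exact h2 t ht x
          · exact h3 t ht x
          · exact h4 t ht x
      _ = _ := by ring

/-- Bilinear embedding: the pairing of `∂ₖ∂ⱼu` with `φ` is controlled by the Bellman function. -/
lemma neg_mul_integral_hess_le {u : EuclideanSpace ℝ (Fin n) → ℝ} (hn : 1 ≤ n)
    (hu : IsTestFun u) (hφ : IsTestFun φ) (hp : 1 < p) (hp₂ : p < 2)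
    (hpq : (p - 1) * (q - 1) = 1) (hq : 2 < q) (hε : 0 < ε) (j k : Fin n) {σ : ℝ}
    (hσ : |σ| = 1) :
    -(σ * ∫ x, hessEntry u j k x * φ x) ≤ 10 * ∫ x, bell p q ε (lap u x) (φ x) := by
  have hf := hu.lap
  set G := fun s => ∫ x, bell p q ε (heat (lap u) s x) (heat φ s x) with hG
  set H := fun s => ∫ x, heat (hessEntry u j k) s x * heat φ s x with hH
  have hd : ∀ s, HasDerivAt (fun s => 10 * G s + σ * H s) _ s := fun s =>
    ((hasDerivAt_integral_bell hf hφ hp hp₂ hq hε s).const_mul 10).add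
      ((hasDerivAt_integral_hess_mul hu hφ j k s).const_mul σ)
  have hanti : AntitoneOn (fun s => 10 * G s + σ * H s) (Set.Ici 0) := by
    refine antitoneOn_of_deriv_nonpos (convex_Ici 0)
      (fun s _ => (hd s).continuousAt.continuousWithinAt)
      (fun s _ => (hd s).differentiableAt.differentiableWithinAt) fun s hs => ?_
    rw [interior_Ici, Set.mem_Ioi] at hs
    rw [(hd s).deriv]
    have hi := integrable_mul_heat (continuous_heat (hf.partialDeriv' j) s)
      (bounded_heat (hf.partialDeriv' j) s) (hφ.partialDeriv' k) s
    have h1 : -(2 * σ * ∫ x, heat (partialDeriv' j (lap u)) s x * heat (partialDeriv' k φ) s x) ≤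
        10 * ∫ x, bellForm p q ε (lap u) φ s x := by
      rw [← integral_const_mul, ← integral_const_mul, ← integral_neg]
      refine integral_mono (hi.const_mul _).neg ((integrable_bellForm hf hφ hq hε s).const_mul 10)
        fun x => ?_
      refine le_trans ?_ (abs_mul_le_sum_bell_hess hp hp₂ hpq hq hε _ _ _ _ j k)
      refine (neg_le_abs _).trans_eq ?_
      rw [abs_mul, abs_mul 2 σ, hσ]
      norm_num
    nlinarith
  have hlim : Filter.Tendsto (fun s => σ * H s) Filter.atTop (nhds 0) := by
    simpa using (tendsto_integral_hess_mul hn (hu.hessEntry j k) hφ).const_mul σ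
  have h0 : (0 : ℝ) ≤ 10 * G 0 + σ * H 0 := by
    refine le_of_tendsto hlim ?_
    filter_upwards [Filter.eventually_ge_atTop 0] with s hs
    have h1 := hanti Set.self_mem_Ici hs hs
    have h2 : 0 ≤ G s := integral_nonneg fun x => bell_nonneg hp hε _ _
    simp only at h1
    linarith
  simp only [hG, hH, heat_zero] at h0
  linarith

end Monotone

section Duality

variable {n : ℕ} {u φ w : EuclideanSpace ℝ (Fin n) → ℝ} {p q δ : ℝ}

lemma IsTestFun.integrable_abs_rpow (hφ : IsTestFun φ) {r : ℝ} (hr : 1 < r) :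
    Integrable fun x => |φ x| ^ r := by
  simpa only [heat_zero] using integrable_abs_heat_rpow hφ 0 hr

lemma integral_hess_mul_le (hn : 1 ≤ n) (hu : IsTestFun u) (hφ : IsTestFun φ) (hp : 1 < p)
    (hp₂ : p < 2) (hpq : (p - 1) * (q - 1) = 1) (hq : 2 < q) (j k : Fin n) :
    ∫ x, hessEntry u j k x * φ x ≤
      10 * ((5 / (p * (p - 1)) + 2) * (∫ x, |lap u x| ^ p) + 2 * ∫ x, |φ x| ^ q) := by
  have hconj : p.HolderConjugate q := by
    rw [Real.holderConjugate_iff]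
    refine ⟨hp, ?_⟩
    field_simp
    linarith
  have hD : 0 ≤ ∫ x, |φ x| := integral_nonneg fun x => abs_nonneg _
  refine le_of_forall_pos_le_add fun η hη => ?_
  set ε := η / (10 * (∫ x, |φ x|) + 1) with hεdef
  have hε : 0 < ε := by positivity
  have hεη : 10 * (ε * ∫ x, |φ x|) ≤ η := by
    have : ε * (10 * (∫ x, |φ x|) + 1) = η := div_mul_cancel₀ _ (by positivity)
    linarith
  have h1 := neg_mul_integral_hess_le hn hu hφ hp hp₂ hpq hq hε j k (σ := -1) (by simp)
  have hb := integrable_bell_heat hu.lap hφ hp hp₂ hq hε 0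
  simp only [heat_zero] at hb
  have hI1 := hu.lap.integrable_abs_rpow hp
  have hI2 := hφ.integrable_abs_rpow (r := q) (by linarith)
  have hI3 : Integrable fun x => (5 / (p * (p - 1)) + 2) * |lap u x| ^ p + 2 * |φ x| ^ q :=
    (hI1.const_mul _).add (hI2.const_mul 2)
  have h2 : ∫ x, bell p q ε (lap u x) (φ x) ≤
      ∫ x, ((5 / (p * (p - 1)) + 2) * |lap u x| ^ p + 2 * |φ x| ^ q + ε * |φ x|) := by
    refine integral_mono hb
      (hI3.add (hφ.integrable.abs.const_mul ε)) fun x => ?_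
    have h3 := bell_le (q := q) hp hp₂ hε (lap u x) (φ x)
    have h4 := Real.young_inequality_of_nonneg (abs_nonneg (lap u x)) (abs_nonneg (φ x)) hconj
    have h5 : |lap u x| ^ p / p ≤ |lap u x| ^ p := div_le_self (by positivity) hp.le
    have h6 : |φ x| ^ q / q ≤ |φ x| ^ q := div_le_self (by positivity) (by linarith)
    simp only
    linarith
  rw [integral_add hI3 (hφ.integrable.abs.const_mul ε),
    integral_add (hI1.const_mul _) (hI2.const_mul 2), integral_const_mul, integral_const_mul,
    integral_const_mul] at h2
  linarith

/-- The regularised duality map `w ↦ w (w² + δ²)^{(p-2)/2}`. -/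
noncomputable def dualMap (p δ w : ℝ) : ℝ := w * (w ^ 2 + δ ^ 2) ^ ((p - 2) / 2)

lemma IsTestFun.const_mul_dualMap (hw : IsTestFun w) (hδ : 0 < δ) (p t : ℝ) :
    IsTestFun fun x => t * dualMap p δ (w x) := by
  refine ⟨?_, ?_⟩
  · exact contDiff_const.mul (hw.1.mul (((hw.1.pow 2).add contDiff_const).rpow_const_of_ne
      fun x => (sq_add_sq_pos_of_pos hδ _).ne'))
  · exact hw.2.comp_left (g := fun w => t * dualMap p δ w) (by simp [dualMap])

lemma mul_dualMap_nonneg (p δ w : ℝ) : 0 ≤ w * dualMap p δ w := by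
  rw [dualMap, ← mul_assoc]
  exact mul_nonneg (mul_self_nonneg w) (by positivity)

lemma abs_dualMap_rpow_le (hpq : (p - 1) * (q - 1) = 1) (hq : 2 < q) (hδ : 0 < δ) (w : ℝ) :
    |dualMap p δ w| ^ q ≤ w * dualMap p δ w := by
  have hP := sq_add_sq_pos_of_pos hδ w
  have h1 : |w| ^ q ≤ w ^ 2 * (w ^ 2 + δ ^ 2) ^ ((q - 2) / 2) := by
    calc |w| ^ q = |w| ^ (2 : ℝ) * |w| ^ (q - 2) := by
          rw [← Real.rpow_add_of_nonneg (abs_nonneg w) (by norm_num) (by linarith)]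
          congr 1; ring
      _ = w ^ 2 * (w ^ 2) ^ ((q - 2) / 2) := by rw [sq_rpow_half, Real.rpow_two, sq_abs]
      _ ≤ _ := by
          refine mul_le_mul_of_nonneg_left (Real.rpow_le_rpow (by positivity) ?_ (by linarith))
            (by positivity)
          nlinarith [sq_nonneg δ]
  rw [dualMap, abs_mul, Real.mul_rpow (abs_nonneg _) (abs_nonneg _),
    abs_of_pos (Real.rpow_pos_of_pos hP _), ← Real.rpow_mul hP.le]
  calc |w| ^ q * (w ^ 2 + δ ^ 2) ^ ((p - 2) / 2 * q)
      ≤ w ^ 2 * (w ^ 2 + δ ^ 2) ^ ((q - 2) / 2) * (w ^ 2 + δ ^ 2) ^ ((p - 2) / 2 * q) :=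
        mul_le_mul_of_nonneg_right h1 (by positivity)
    _ = w * (w * (w ^ 2 + δ ^ 2) ^ ((p - 2) / 2)) := by
        rw [mul_assoc, ← Real.rpow_add hP, ← mul_assoc, ← sq]
        congr 2
        linear_combination hpq / 2

lemma integral_mul_dualMap_hess_le (hn : 1 ≤ n) (hu : IsTestFun u) (hp : 1 < p)
    (hp₂ : p < 2) (hδ : 0 < δ) (j k : Fin n) :
    ∫ x, hessEntry u j k x * dualMap p δ (hessEntry u j k x) ≤
      800 * (5 / (p * (p - 1)) + 2) * ∫ x, |lap u x| ^ p := by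
  have hp0 : 0 < p - 1 := by linarith
  obtain ⟨q, hpq⟩ : ∃ q, (p - 1) * (q - 1) = 1 := ⟨1 + (p - 1)⁻¹, by field_simp; ring⟩
  have hq : 2 < q := by nlinarith
  have hw := hu.hessEntry j k
  set A := ∫ x, hessEntry u j k x * dualMap p δ (hessEntry u j k x) with hA
  have hi : Integrable fun x => hessEntry u j k x * dualMap p δ (hessEntry u j k x) := by
    simpa only [heat_zero, one_mul] using integrable_mul_heat hw.continuous
      (hw.exists_bound.imp fun _ h => h.2) (hw.const_mul_dualMap hδ p 1) 0
  have hφ := hw.const_mul_dualMap hδ p (1 / 40)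
  have h1 := integral_hess_mul_le hn hu hφ hp hp₂ hpq hq j k
  have h2 : ∫ x, hessEntry u j k x * (1 / 40 * dualMap p δ (hessEntry u j k x)) = 1 / 40 * A := by
    rw [hA, ← integral_const_mul]
    exact integral_congr_ae (Filter.Eventually.of_forall fun x => by simp only; ring)
  have h3 : ∫ x, |1 / 40 * dualMap p δ (hessEntry u j k x)| ^ q ≤ (1 / 40) ^ 2 * A := by
    rw [hA, ← integral_const_mul]
    refine integral_mono (hφ.integrable_abs_rpow (by linarith)) (hi.const_mul _) fun x => ?_
    simp only
    rw [abs_mul, Real.mul_rpow (abs_nonneg _) (abs_nonneg _), abs_of_pos (by norm_num)]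
    refine mul_le_mul ?_ (abs_dualMap_rpow_le hpq hq hδ _) (by positivity) (by positivity)
    rw [← Real.rpow_two]
    exact Real.rpow_le_rpow_of_exponent_ge (by norm_num) (by norm_num) hq.le
  rw [h2] at h1
  linarith

lemma tendsto_mul_dualMap (hp : 1 < p) (w : ℝ) :
    Filter.Tendsto (fun m : ℕ => w * dualMap p (1 / (m + 1)) w) Filter.atTop
      (nhds (|w| ^ p)) := by
  rcases eq_or_ne w 0 with rfl | hw
  · simp [Real.zero_rpow (by linarith : p ≠ 0)]
  · have h0 : 0 < w ^ 2 := by positivity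
    have h1 : Filter.Tendsto (fun m : ℕ => w ^ 2 + (1 / ((m : ℝ) + 1)) ^ 2) Filter.atTop
        (nhds (w ^ 2)) := by
      simpa using (tendsto_one_div_add_atTop_nhds_zero_nat (𝕜 := ℝ)).pow 2 |>.const_add (w ^ 2)
    have h2 := (h1.rpow_const (p := (p - 2) / 2) (Or.inl h0.ne')).const_mul (w ^ 2)
    have h3 : w ^ 2 * (w ^ 2) ^ ((p - 2) / 2) = |w| ^ p := by
      rw [← sq_rpow_half, mul_comm, ← Real.rpow_add_one h0.ne']
      congr 1; ring
    rw [h3] at h2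
    refine h2.congr fun m => ?_
    rw [dualMap]; ring

/-- The `L^p` estimate for a single second derivative. -/
lemma lintegral_abs_hessEntry_rpow_le (hn : 1 ≤ n) (hu : IsTestFun u) (hp : 1 < p)
    (hp₂ : p < 2) (j k : Fin n) :
    ∫⁻ x, ENNReal.ofReal (|hessEntry u j k x| ^ p) ≤
      ENNReal.ofReal (800 * (5 / (p * (p - 1)) + 2)) *
        ∫⁻ x, ENNReal.ofReal (|lap u x| ^ p) := by
  have hp0 : 0 < p - 1 := by linarith
  have hw := hu.hessEntry j k
  have hδ : ∀ m : ℕ, (0 : ℝ) < 1 / (m + 1) := fun m => by positivity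
  have hc : ∀ m : ℕ, Continuous fun x =>
      hessEntry u j k x * dualMap p (1 / (m + 1)) (hessEntry u j k x) := fun m => by
    have h := (hw.const_mul_dualMap (hδ m) p 1).continuous
    simp only [one_mul] at h
    exact hw.continuous.mul h
  have hi : ∀ m : ℕ, Integrable fun x =>
      hessEntry u j k x * dualMap p (1 / (m + 1)) (hessEntry u j k x) := fun m =>
    (hc m).integrable_of_hasCompactSupport hw.2.mul_right
  rw [← ofReal_integral_eq_lintegral_ofReal (hu.lap.integrable_abs_rpow hp)
    (Filter.Eventually.of_forall fun x => by positivity), ← ENNReal.ofReal_mul (by positivity)]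
  calc ∫⁻ x, ENNReal.ofReal (|hessEntry u j k x| ^ p)
      = ∫⁻ x, Filter.liminf (fun m : ℕ => ENNReal.ofReal
          (hessEntry u j k x * dualMap p (1 / (m + 1)) (hessEntry u j k x))) Filter.atTop :=
        lintegral_congr fun x =>
          (ENNReal.tendsto_ofReal (tendsto_mul_dualMap hp _)).liminf_eq.symm
    _ ≤ Filter.liminf (fun m : ℕ => ∫⁻ x, ENNReal.ofReal
          (hessEntry u j k x * dualMap p (1 / (m + 1)) (hessEntry u j k x))) Filter.atTop :=
        lintegral_liminf_le fun m => (hc m).measurable.ennreal_ofReal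
    _ ≤ _ := by
        refine Filter.liminf_le_of_frequently_le' (Filter.Frequently.of_forall fun m => ?_)
        rw [← ofReal_integral_eq_lintegral_ofReal (hi m)
          (Filter.Eventually.of_forall fun x => mul_dualMap_nonneg _ _ _)]
        exact ENNReal.ofReal_le_ofReal (integral_mul_dualMap_hess_le hn hu hp hp₂ (hδ m) j k)

lemma rpow_sum_le_sum_rpow {ι : Type*} (s : Finset ι) {a : ι → ℝ} (ha : ∀ i, 0 ≤ a i) {r : ℝ}
    (hr : 0 < r) (hr₁ : r ≤ 1) : (∑ i ∈ s, a i) ^ r ≤ ∑ i ∈ s, a i ^ r := by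
  classical
  induction s using Finset.induction_on with
  | empty => simp [Real.zero_rpow hr.ne']
  | insert i s hi ih =>
    rw [Finset.sum_insert hi, Finset.sum_insert hi]
    exact (Real.rpow_add_le_add_rpow (ha i) (Finset.sum_nonneg fun j _ => ha j) hr.le hr₁).trans
      (by gcongr)

lemma sqrt_hessFrobSq_rpow_le (hp : 0 < p) (hp₂ : p < 2) (x : EuclideanSpace ℝ (Fin n)) :
    √(hessFrobSq u x) ^ p ≤ ∑ i, ∑ j, |hessEntry u i j x| ^ p := by
  have h0 : ∀ i, 0 ≤ ∑ j, hessEntry u i j x ^ 2 := fun i =>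
    Finset.sum_nonneg fun j _ => sq_nonneg _
  rw [hessFrobSq, Real.sqrt_eq_rpow, ← Real.rpow_mul (Finset.sum_nonneg fun i _ => h0 i),
    show 1 / 2 * p = p / 2 by ring]
  refine (rpow_sum_le_sum_rpow _ h0 (by linarith) (by linarith)).trans
    (Finset.sum_le_sum fun i _ => ?_)
  refine (rpow_sum_le_sum_rpow _ (fun j => sq_nonneg _) (by linarith) (by linarith)).trans_eq ?_
  exact Finset.sum_congr rfl fun j _ => sq_rpow_half _

end Duality

/-- Global `W^{2,p}` estimate `‖D²u‖_{L^p(ℝⁿ)} ≤ C ‖Δu‖_{L^p(ℝⁿ)}` for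
compactly supported smooth `u`, in the range `1 < p < 2`. -/
theorem global_W2p_estimate (n : ℕ) (hn : 1 ≤ n) (p : ℝ) (hp₁ : 1 < p) (hp₂ : p < 2) :
    ∃ C : ℝ, 0 < C ∧
      ∀ u : EuclideanSpace ℝ (Fin n) → ℝ,
        ContDiff ℝ (⊤ : ℕ∞) u → HasCompactSupport u →
        (∫⁻ x, ENNReal.ofReal (Real.sqrt (hessFrobSq u x) ^ p)) ^ (1 / p) ≤
          ENNReal.ofReal C * (∫⁻ x, ENNReal.ofReal (|lap u x| ^ p)) ^ (1 / p) := by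
  have hp0 : 0 < p - 1 := by linarith
  have hn0 : (0 : ℝ) < n := by exact_mod_cast hn
  set B : ℝ := 800 * (5 / (p * (p - 1)) + 2) with hB
  have hB0 : 0 < B := by positivity
  refine ⟨(n * (n * B)) ^ (1 / p), by positivity, fun u hu hc => ?_⟩
  have hu' : IsTestFun u := ⟨hu, hc⟩
  rw [← ENNReal.ofReal_rpow_of_pos (by positivity),
    ← ENNReal.mul_rpow_of_nonneg _ _ (by positivity : 0 ≤ 1 / p)]
  refine ENNReal.rpow_le_rpow ?_ (by positivity)
  have hm : ∀ i j, Measurable fun x => ENNReal.ofReal (|hessEntry u i j x| ^ p) := fun i j =>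
    ((hu'.hessEntry i j).continuous.abs.rpow_const
      fun _ => Or.inr (by linarith)).measurable.ennreal_ofReal
  calc ∫⁻ x, ENNReal.ofReal (√(hessFrobSq u x) ^ p)
      ≤ ∫⁻ x, ∑ i, ∑ j, ENNReal.ofReal (|hessEntry u i j x| ^ p) := by
        refine lintegral_mono fun x => ?_
        refine (ENNReal.ofReal_le_ofReal
          (sqrt_hessFrobSq_rpow_le (by linarith) hp₂ x)).trans_eq ?_
        rw [ENNReal.ofReal_sum_of_nonneg fun i _ => Finset.sum_nonneg fun j _ => by positivity]
        exact Finset.sum_congr rfl fun i _ =>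
          ENNReal.ofReal_sum_of_nonneg fun j _ => by positivity
    _ = ∑ i, ∑ j, ∫⁻ x, ENNReal.ofReal (|hessEntry u i j x| ^ p) := by
        rw [lintegral_finsetSum _ fun i _ => Finset.measurable_sum _ fun j _ => hm i j]
        exact Finset.sum_congr rfl fun i _ => lintegral_finsetSum _ fun j _ => hm i j
    _ ≤ ∑ _i : Fin n, ∑ _j : Fin n,
          ENNReal.ofReal B * ∫⁻ x, ENNReal.ofReal (|lap u x| ^ p) :=
        Finset.sum_le_sum fun i _ => Finset.sum_le_sum fun j _ =>
          lintegral_abs_hessEntry_rpow_le hn hu' hp₁ hp₂ i j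
    _ = ENNReal.ofReal (n * (n * B)) * ∫⁻ x, ENNReal.ofReal (|lap u x| ^ p) := by
        rw [ENNReal.ofReal_mul hn0.le, ENNReal.ofReal_mul hn0.le, ENNReal.ofReal_natCast]
        simp [mul_assoc]
end

section
/- Let n ≥ 1 and let v : ℝⁿ → ℝ be smooth and harmonic, i.e. Δv = 0 on all of ℝⁿ. Assume: (i) ⨍_{B₁} v = 0, ⨍_{B₁} ∇v = 0, and ⨍_{B₁} D²v = 0 (entrywise); (ii) ∫_{B_R} |D²v|² ≤ Rⁿ(1+Rⁿ) for every R > 1; (iii) ⨍_{B_R} |D²v − (D²v)̄_{B_R}|² ≤ 1 for every R > 1. Then v ≡ 0 on ℝⁿ. -/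
open MeasureTheory Metric

section PartialDerivatives

variable {n : ℕ} {u : EuclideanSpace ℝ (Fin n) → ℝ}

lemma contDiff_partialDeriv' (hu : ContDiff ℝ (⊤ : ℕ∞) u) (i : Fin n) :
    ContDiff ℝ (⊤ : ℕ∞) (partialDeriv' i u) :=
  (hu.fderiv_right (m := ((⊤ : ℕ∞) : WithTop ℕ∞)) (by simp)).clm_apply contDiff_const

lemma partialDeriv'_comm (hu : ContDiff ℝ (⊤ : ℕ∞) u) (i j : Fin n) :
    partialDeriv' i (partialDeriv' j u) = partialDeriv' j (partialDeriv' i u) := by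
  funext x
  have hd : Differentiable ℝ (fderiv ℝ u) :=
    (hu.fderiv_right (m := ((⊤ : ℕ∞) : WithTop ℕ∞)) (by simp)).differentiable (by simp)
  have key (a b : Fin n) : partialDeriv' a (partialDeriv' b u) x =
      fderiv ℝ (fderiv ℝ u) x (EuclideanSpace.single a 1) (EuclideanSpace.single b 1) := by
    have h := (hd x).hasFDerivAt.clm_apply
      (hasFDerivAt_const (EuclideanSpace.single b (1 : ℝ)) x)
    unfold partialDeriv'
    rw [h.fderiv]
    simp
  rw [key, key]
  exact (hu.contDiffAt.isSymmSndFDerivAt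
    (by simpa using WithTop.coe_le_coe.2 (le_top (a := (2 : ℕ∞))))).eq _ _

lemma lap_partialDeriv' (hu : ContDiff ℝ (⊤ : ℕ∞) u) (hharm : ∀ x, lap u x = 0) (i : Fin n)
    (x : EuclideanSpace ℝ (Fin n)) : lap (partialDeriv' i u) x = 0 := by
  have hs (k : Fin n) : ContDiff ℝ (⊤ : ℕ∞) (hessEntry u k k) :=
    contDiff_partialDeriv' (contDiff_partialDeriv' hu k) k
  have h0 : lap u = fun _ => 0 := funext hharm
  have h1 : partialDeriv' i (lap u) x = 0 := by simp [h0, partialDeriv']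
  rw [← h1]
  have h2 : lap u = fun x => ∑ k, hessEntry u k k x := rfl
  unfold lap
  rw [partialDeriv', fderiv_fun_sum fun k _ => (hs k).differentiable (by simp) x]
  simp only [sum_apply]
  refine Finset.sum_congr rfl fun k _ => ?_
  change partialDeriv' k (partialDeriv' k (partialDeriv' i u)) x =
    partialDeriv' i (partialDeriv' k (partialDeriv' k u)) x
  rw [partialDeriv'_comm hu k i, partialDeriv'_comm (contDiff_partialDeriv' hu k) k i]

lemma fderiv_eq_sum_partialDeriv' (z x : EuclideanSpace ℝ (Fin n)) :
    fderiv ℝ u z x = ∑ i, x i * partialDeriv' i u z := by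
  conv_lhs => rw [← (EuclideanSpace.basisFun (Fin n) ℝ).sum_repr x]
  simp [partialDeriv']

lemma eq_of_partialDeriv'_eq_zero (hu : ContDiff ℝ (⊤ : ℕ∞) u)
    (h : ∀ i x, partialDeriv' i u x = 0) (x y : EuclideanSpace ℝ (Fin n)) : u x = u y := by
  refine is_const_of_fderiv_eq_zero (hu.differentiable (by simp)) (fun z => ?_) x y
  ext w
  simp [fderiv_eq_sum_partialDeriv', h]

end PartialDerivatives

lemma hasDerivAt_max_zero_sq (s : ℝ) :
    HasDerivAt (fun s : ℝ => max 0 s ^ 2) (2 * max 0 s) s := by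
  rcases lt_trichotomy s 0 with hs | rfl | hs
  · rw [max_eq_left hs.le, mul_zero]
    refine (hasDerivAt_const s (0 : ℝ)).congr_of_eventuallyEq ?_
    filter_upwards [gt_mem_nhds hs] with r hr
    simp [max_eq_left (le_of_lt hr)]
  · rw [hasDerivAt_iff_isLittleO]
    refine Asymptotics.IsBigO.trans_isLittleO (g := fun r : ℝ => r ^ 2)
      (Asymptotics.IsBigO.of_bound 1 (.of_forall fun r => ?_)) ?_
    · rcases le_total 0 r with h | h <;> simp [h, sq_nonneg]
    · simpa using (Asymptotics.isLittleO_pow_id (𝕜 := ℝ) one_lt_two)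
  · rw [max_eq_right hs.le]
    refine HasDerivAt.congr_of_eventuallyEq (f := fun r : ℝ => r ^ 2)
      (by simpa using hasDerivAt_pow 2 s) ?_
    filter_upwards [lt_mem_nhds hs] with r hr
    simp [max_eq_right (le_of_lt hr)]

/-- The radial weight `(R² - |x|²)₊`. -/
noncomputable def radialWeight {n : ℕ} (R : ℝ) (x : EuclideanSpace ℝ (Fin n)) : ℝ :=
  max 0 (R ^ 2 - ‖x‖ ^ 2)

section RadialWeight

variable {n : ℕ} {u : EuclideanSpace ℝ (Fin n) → ℝ}

lemma continuous_radialWeight (R : ℝ) :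
    Continuous (radialWeight R : EuclideanSpace ℝ (Fin n) → ℝ) := by
  unfold radialWeight; fun_prop

lemma radialWeight_nonneg (R : ℝ) (x : EuclideanSpace ℝ (Fin n)) : 0 ≤ radialWeight R x :=
  le_max_left _ _

lemma radialWeight_eq_zero {R : ℝ} (hR : 0 ≤ R) {x : EuclideanSpace ℝ (Fin n)} (hx : R ≤ ‖x‖) :
    radialWeight R x = 0 :=
  max_eq_left (by nlinarith)

lemma hasCompactSupport_radialWeight {R : ℝ} (hR : 0 ≤ R) :
    HasCompactSupport (radialWeight R : EuclideanSpace ℝ (Fin n) → ℝ) := by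
  refine HasCompactSupport.intro (isCompact_closedBall 0 R) fun x hx => ?_
  refine radialWeight_eq_zero hR ?_
  simp at hx
  exact hx.le

lemma integrable_radialWeight_mul {R : ℝ} (hR : 0 ≤ R) {g : EuclideanSpace ℝ (Fin n) → ℝ}
    (hg : Continuous g) : Integrable fun x => radialWeight R x * g x :=
  ((continuous_radialWeight R).mul hg).integrable_of_hasCompactSupport
    (hasCompactSupport_radialWeight hR).mul_right

lemma integrable_radialWeight {R : ℝ} (hR : 0 ≤ R) :
    Integrable (radialWeight R : EuclideanSpace ℝ (Fin n) → ℝ) :=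
  (continuous_radialWeight R).integrable_of_hasCompactSupport (hasCompactSupport_radialWeight hR)

lemma hasFDerivAt_radialWeight_sq (R : ℝ) (x : EuclideanSpace ℝ (Fin n)) :
    HasFDerivAt (fun x : EuclideanSpace ℝ (Fin n) => radialWeight R x ^ 2)
      ((2 * radialWeight R x) • (-(2 • innerSL ℝ x : EuclideanSpace ℝ (Fin n) →L[ℝ] ℝ))) x :=
  HasDerivAt.comp_hasFDerivAt (h₂ := fun s : ℝ => max 0 s ^ 2) x
    (hasDerivAt_max_zero_sq (R ^ 2 - ‖x‖ ^ 2))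
    ((hasStrictFDerivAt_norm_sq x).hasFDerivAt.const_sub (R ^ 2))

lemma integral_radialWeight_mul_fderiv_eq_zero (hu : ContDiff ℝ (⊤ : ℕ∞) u)
    (hharm : ∀ x, lap u x = 0) {R : ℝ} (hR : 0 ≤ R) (y : EuclideanSpace ℝ (Fin n)) (t : ℝ) :
    ∫ x, radialWeight R x * fderiv ℝ u (y + t • x) x = 0 := by
  have hX (i : Fin n) : ContDiff ℝ (⊤ : ℕ∞) fun x => partialDeriv' i u (y + t • x) :=
    (contDiff_partialDeriv' hu i).comp (by fun_prop)
  have hdX (i : Fin n) (x : EuclideanSpace ℝ (Fin n)) :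
      fderiv ℝ (fun x => partialDeriv' i u (y + t • x)) x (EuclideanSpace.single i 1) =
        t * hessEntry u i i (y + t • x) := by
    have h1 : HasFDerivAt (fun x : EuclideanSpace ℝ (Fin n) => y + t • x)
        (t • ContinuousLinearMap.id ℝ _) x := ((hasFDerivAt_id x).const_smul t).const_add y
    have h2 := (((contDiff_partialDeriv' hu i).differentiable (by simp)
      (y + t • x)).hasFDerivAt.comp x h1).fderiv
    have h3 : (partialDeriv' i u ∘ fun x => y + t • x) =
      fun x => partialDeriv' i u (y + t • x) := rfl
    rw [h3] at h2
    rw [h2]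
    simp [hessEntry, partialDeriv']
  have hdq (i : Fin n) (x : EuclideanSpace ℝ (Fin n)) :
      fderiv ℝ (fun x : EuclideanSpace ℝ (Fin n) => radialWeight R x ^ 2) x
        (EuclideanSpace.single i 1) = -4 * (radialWeight R x * x i) := by
    rw [(hasFDerivAt_radialWeight_sq R x).fderiv]
    simp [EuclideanSpace.inner_single_right]
    ring
  have hcoord (i : Fin n) : Continuous fun x : EuclideanSpace ℝ (Fin n) => x i := by fun_prop
  have hcH (i : Fin n) : Continuous (hessEntry u i i) :=
    (contDiff_partialDeriv' (contDiff_partialDeriv' hu i) i).continuous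
  have hcHy (i : Fin n) : Continuous fun x => hessEntry u i i (y + t • x) :=
    (hcH i).comp (by fun_prop)
  have hw := continuous_radialWeight (n := n) R
  have hint (i : Fin n) :
      Integrable fun x => radialWeight R x * (x i * partialDeriv' i u (y + t • x)) :=
    integrable_radialWeight_mul hR ((hcoord i).mul (hX i).continuous)
  have hint' (i : Fin n) :
      Integrable fun x => radialWeight R x ^ 2 * (t * hessEntry u i i (y + t • x)) := by
    simp_rw [sq, mul_assoc]
    exact integrable_radialWeight_mul hR (hw.mul ((hcHy i).const_mul t))
  have hparts (i : Fin n) :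
      4 * ∫ x, radialWeight R x * (x i * partialDeriv' i u (y + t • x)) =
        ∫ x, radialWeight R x ^ 2 * (t * hessEntry u i i (y + t • x)) := by
    have h := integral_mul_fderiv_eq_neg_fderiv_mul_of_integrable (μ := volume)
      (f := fun x : EuclideanSpace ℝ (Fin n) => radialWeight R x ^ 2)
      (g := fun x => partialDeriv' i u (y + t • x)) (v := EuclideanSpace.single i 1)
      ?_ ?_ ?_ ?_ ?_
    · simp_rw [hdX, hdq] at h
      rw [h, ← integral_neg, ← integral_const_mul]
      congr with x
      ring
    · simp_rw [hdq]
      convert (hint i).const_mul (-4) using 2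
      ring
    · simp_rw [hdX]
      exact hint' i
    · simp_rw [sq, mul_assoc]
      exact integrable_radialWeight_mul hR (hw.mul (hX i).continuous)
    · exact fun x _ => (hasFDerivAt_radialWeight_sq R x).differentiableAt
    · exact fun x _ => (hX i).differentiable (by simp) x
  have hsum : 4 * ∫ x, radialWeight R x * fderiv ℝ u (y + t • x) x =
      ∫ x, radialWeight R x ^ 2 * (t * lap u (y + t • x)) := by
    simp_rw [fderiv_eq_sum_partialDeriv', lap, Finset.mul_sum]
    rw [integral_finsetSum _ fun i _ => hint i, integral_finsetSum _ fun i _ => hint' i,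
      Finset.mul_sum]
    exact Finset.sum_congr rfl fun i _ => hparts i
  simp only [hharm, mul_zero, integral_zero] at hsum
  linarith

/-- Weighted mean value property of harmonic functions. -/
lemma integral_radialWeight_mul_eq (hu : ContDiff ℝ (⊤ : ℕ∞) u)
    (hharm : ∀ x, lap u x = 0) {R : ℝ} (hR : 0 ≤ R) (y : EuclideanSpace ℝ (Fin n)) :
    ∫ x, radialWeight R x * u (y + x) =
      u y * ∫ x : EuclideanSpace ℝ (Fin n), radialWeight R x := by
  have hdu : Continuous (fderiv ℝ u) := hu.continuous_fderiv (by simp)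
  have hcont : Continuous fun p : ℝ × EuclideanSpace ℝ (Fin n) =>
      radialWeight R p.2 * fderiv ℝ u (y + p.1 • p.2) p.2 :=
    ((continuous_radialWeight R).comp continuous_snd).mul
      ((hdu.comp (by fun_prop)).clm_apply continuous_snd)
  have hftc (x : EuclideanSpace ℝ (Fin n)) :
      ∫ t in (0 : ℝ)..1, radialWeight R x * fderiv ℝ u (y + t • x) x =
        radialWeight R x * u (y + x) - radialWeight R x * u y := by
    rw [intervalIntegral.integral_const_mul,
      intervalIntegral.integral_eq_sub_of_hasDerivAt (f := fun t : ℝ => u (y + t • x))]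
    · simp [mul_sub]
    · intro t _
      have h1 : HasDerivAt (fun t : ℝ => y + t • x) x t := by
        simpa using ((hasDerivAt_id t).smul_const x).const_add y
      exact (hu.differentiable (by simp) (y + t • x)).hasFDerivAt.comp_hasDerivAt t h1
    · exact ((hdu.comp (by fun_prop)).clm_apply continuous_const).intervalIntegrable _ _
  have hprod : Integrable (Function.uncurry fun (t : ℝ) (x : EuclideanSpace ℝ (Fin n)) =>
      radialWeight R x * fderiv ℝ u (y + t • x) x)
      ((volume.restrict (Set.uIoc (0 : ℝ) 1)).prod volume) := by
    rw [← Measure.restrict_univ (μ := (volume : Measure (EuclideanSpace ℝ (Fin n)))),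
      Measure.prod_restrict]
    change IntegrableOn _ _ _
    have hK : IntegrableOn (Function.uncurry fun (t : ℝ) (x : EuclideanSpace ℝ (Fin n)) =>
        radialWeight R x * fderiv ℝ u (y + t • x) x)
        (Set.Icc (0 : ℝ) 1 ×ˢ closedBall 0 R) (volume.prod volume) :=
      hcont.continuousOn.integrableOn_compact (isCompact_Icc.prod (isCompact_closedBall 0 R))
    refine hK.of_forall_sdiff_eq_zero ?_ ?_
    · exact measurableSet_uIoc.prod .univ
    · rintro ⟨t, x⟩ ⟨⟨ht, -⟩, hx⟩
      rw [Set.uIoc_of_le zero_le_one] at ht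
      have hx' : R ≤ ‖x‖ := by
        by_contra! h
        exact hx ⟨⟨ht.1.le, ht.2⟩, by simpa using h.le⟩
      simp [radialWeight_eq_zero hR hx']
  have huy : Continuous fun x => u (y + x) := hu.continuous.comp (by fun_prop)
  have hswap := intervalIntegral_integral_swap hprod
  simp_rw [integral_radialWeight_mul_fderiv_eq_zero hu hharm hR y, hftc] at hswap
  rw [integral_sub (integrable_radialWeight_mul hR huy)
    (integrable_radialWeight_mul hR continuous_const), integral_mul_const] at hswap
  simp at hswap
  linarith

lemma integral_radialWeight {R : ℝ} (hR : 0 < R) :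
    ∫ x : EuclideanSpace ℝ (Fin n), radialWeight R x =
      R ^ (n + 2) * ∫ x : EuclideanSpace ℝ (Fin n), radialWeight 1 x := by
  have hscale (x : EuclideanSpace ℝ (Fin n)) :
      radialWeight R (R • x) = R ^ 2 * radialWeight 1 x := by
    rw [radialWeight, radialWeight, mul_max_of_nonneg _ _ (sq_nonneg R), norm_smul,
      Real.norm_of_nonneg hR.le]
    congr 1 <;> ring
  have h := Measure.integral_comp_smul (volume : Measure (EuclideanSpace ℝ (Fin n)))
    (radialWeight R) R
  simp_rw [hscale, integral_const_mul, finrank_euclideanSpace_fin, smul_eq_mul] at h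
  rw [abs_of_pos (by positivity)] at h
  rw [pow_add, mul_assoc, h]
  field_simp

lemma integral_radialWeight_pos {R : ℝ} (hR : 0 < R) :
    0 < ∫ x : EuclideanSpace ℝ (Fin n), radialWeight R x :=
  (continuous_radialWeight R).integral_pos_of_hasCompactSupport_nonneg_nonzero
    (hasCompactSupport_radialWeight hR.le) (radialWeight_nonneg R) (x := 0)
    (by simp [radialWeight, max_eq_right (sq_nonneg R), hR.ne'])

lemma radialWeight_sub_le {R : ℝ} (hR : 0 ≤ R) (x a : EuclideanSpace ℝ (Fin n)) :
    radialWeight R (x - a) ≤ radialWeight (R + ‖a‖) x := by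
  rcases le_total R ‖x - a‖ with h | h
  · rw [radialWeight_eq_zero hR h]
    exact radialWeight_nonneg _ _
  · refine max_le_max le_rfl ?_
    have h1 : ‖x‖ ≤ ‖x - a‖ + ‖a‖ := by simpa using norm_add_le (x - a) a
    nlinarith [norm_nonneg a, norm_nonneg x, norm_nonneg (x - a),
      mul_nonneg (norm_nonneg a) (sub_nonneg.2 h)]

lemma integral_radialWeight_mul_sub_eq (hu : ContDiff ℝ (⊤ : ℕ∞) u)
    (hharm : ∀ x, lap u x = 0) {R : ℝ} (hR : 0 ≤ R) (y : EuclideanSpace ℝ (Fin n)) (m : ℝ) :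
    ∫ x, radialWeight R x * (u (y + x) - m) =
      (u y - m) * ∫ x : EuclideanSpace ℝ (Fin n), radialWeight R x := by
  have huy : Continuous fun x => u (y + x) := hu.continuous.comp (by fun_prop)
  simp_rw [mul_sub]
  rw [integral_sub (integrable_radialWeight_mul hR huy)
    (integrable_radialWeight_mul hR continuous_const), integral_mul_const,
    integral_radialWeight_mul_eq hu hharm hR]
  ring

end RadialWeight

section Liouville

variable {n : ℕ} {u : EuclideanSpace ℝ (Fin n) → ℝ}

/-- A harmonic function on `ℝⁿ` that is bounded below is constant. -/
lemma harmonic_le_of_bddBelow (hu : ContDiff ℝ (⊤ : ℕ∞) u) (hharm : ∀ x, lap u x = 0) {m : ℝ}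
    (hm : ∀ x, m ≤ u x) (y z : EuclideanSpace ℝ (Fin n)) : u y ≤ u z := by
  have hbound (R : ℝ) (hR : 0 < R) :
      u y - m ≤ (u z - m) * (1 + ‖y - z‖ * R⁻¹) ^ (n + 2) := by
    have hR' : 0 < R + ‖y - z‖ := by positivity
    have huz : Continuous fun x => u (z + x) - m :=
      (hu.continuous.comp (by fun_prop)).sub continuous_const
    have hle : (u y - m) * ∫ x : EuclideanSpace ℝ (Fin n), radialWeight R x ≤
        (u z - m) * ∫ x : EuclideanSpace ℝ (Fin n), radialWeight (R + ‖y - z‖) x := by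
      rw [← integral_radialWeight_mul_sub_eq hu hharm hR.le,
        ← integral_radialWeight_mul_sub_eq hu hharm hR'.le]
      rw [← integral_sub_right_eq_self _ (y - z)]
      refine integral_mono_of_nonneg (.of_forall fun x => ?_)
        (integrable_radialWeight_mul hR'.le huz) (.of_forall fun x => ?_)
      · exact mul_nonneg (radialWeight_nonneg _ _) (sub_nonneg.2 (hm _))
      · have hx : y + (x - (y - z)) = z + x := by abel
        simp only [hx]
        exact mul_le_mul_of_nonneg_right (radialWeight_sub_le hR.le _ _) (sub_nonneg.2 (hm _))
    rw [integral_radialWeight hR, integral_radialWeight hR', ← mul_assoc, ← mul_assoc] at hle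
    have hle' := le_of_mul_le_mul_right hle (integral_radialWeight_pos one_pos)
    have hfac : R + ‖y - z‖ = R * (1 + ‖y - z‖ * R⁻¹) := by field_simp
    rw [hfac, mul_pow, mul_left_comm, mul_comm] at hle'
    exact le_of_mul_le_mul_left hle' (by positivity)
  have hlim : Filter.Tendsto (fun R : ℝ => (u z - m) * (1 + ‖y - z‖ * R⁻¹) ^ (n + 2))
      Filter.atTop (nhds ((u z - m) * (1 + ‖y - z‖ * 0) ^ (n + 2))) :=
    (((tendsto_inv_atTop_zero.const_mul _).const_add _).pow _).const_mul _
  have := ge_of_tendsto hlim ((Filter.eventually_gt_atTop 0).mono hbound)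
  simp at this
  linarith

lemma integrableOn_ball_of_continuous (hu : Continuous u) (R : ℝ) :
    IntegrableOn u (ball 0 R) :=
  (hu.continuousOn.integrableOn_compact (isCompact_closedBall 0 R)).mono_set ball_subset_closedBall

lemma abs_sub_mul_integral_radialWeight_le (hu : ContDiff ℝ (⊤ : ℕ∞) u) (hharm : ∀ x, lap u x = 0)
    {R m : ℝ} (hR : 0 < R)
    (hosc : ∫ x in ball (0 : EuclideanSpace ℝ (Fin n)) (2 * R), (u x - m) ^ 2 ≤
      volume.real (ball (0 : EuclideanSpace ℝ (Fin n)) (2 * R)))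
    {y : EuclideanSpace ℝ (Fin n)} (hy : ‖y‖ ≤ R) :
    |u y - m| * ∫ x : EuclideanSpace ℝ (Fin n), radialWeight R x ≤
      R ^ 2 * volume.real (ball (0 : EuclideanSpace ℝ (Fin n)) (2 * R)) := by
  set B := ball (0 : EuclideanSpace ℝ (Fin n)) (2 * R) with hB
  let F : EuclideanSpace ℝ (Fin n) → ℝ := B.indicator fun x => R ^ 2 * ((1 + (u x - m) ^ 2) / 2)
  have hfin : volume B ≠ ⊤ := measure_ball_lt_top.ne
  have hsq : IntegrableOn (fun x => (u x - m) ^ 2) B :=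
    integrableOn_ball_of_continuous ((hu.continuous.sub continuous_const).pow 2) (2 * R)
  have hone : IntegrableOn (fun _ : EuclideanSpace ℝ (Fin n) => (1 : ℝ)) B :=
    integrableOn_const hfin
  have hF : Integrable F := by
    rw [integrable_indicator_iff measurableSet_ball]
    exact ((hone.add hsq).div_const 2).const_mul _
  have hFint : ∫ x, F x ≤ R ^ 2 * volume.real B := by
    rw [integral_indicator measurableSet_ball, integral_const_mul, integral_div,
      integral_add hone hsq]
    simp only [integral_const, smul_eq_mul, mul_one, measureReal_restrict_apply_univ]
    gcongr
    linarith
  have hpt (x : EuclideanSpace ℝ (Fin n)) : radialWeight R x * |u (y + x) - m| ≤ F (y + x) := by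
    rcases le_or_gt R ‖x‖ with hx | hx
    · rw [radialWeight_eq_zero hR.le hx, zero_mul]
      exact Set.indicator_nonneg (fun x _ => by positivity) _
    · have hmem : y + x ∈ B := by
        rw [hB, mem_ball_zero_iff]
        linarith [norm_add_le y x]
      simp only [F, Set.indicator_of_mem hmem]
      refine mul_le_mul ?_ ?_ (abs_nonneg _) (sq_nonneg R)
      · exact max_le (sq_nonneg R) (by linarith [sq_nonneg ‖x‖])
      · nlinarith [sq_nonneg (|u (y + x) - m| - 1), sq_abs (u (y + x) - m)]
  have hpos := integral_radialWeight_pos (n := n) hR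
  calc |u y - m| * ∫ x : EuclideanSpace ℝ (Fin n), radialWeight R x
      = |∫ x, radialWeight R x * (u (y + x) - m)| := by
        rw [integral_radialWeight_mul_sub_eq hu hharm hR.le, abs_mul, abs_of_pos hpos]
    _ ≤ ∫ x, |radialWeight R x * (u (y + x) - m)| := abs_integral_le_integral_abs
    _ ≤ ∫ x, F (y + x) := by
        refine integral_mono_of_nonneg (.of_forall fun x => abs_nonneg _)
          (hF.comp_add_left y) (.of_forall fun x => ?_)
        simp only [abs_mul, abs_of_nonneg (radialWeight_nonneg R x)]
        exact hpt x
    _ = ∫ x, F x := integral_add_left_eq_self F y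
    _ ≤ _ := hFint

/-- A harmonic function on `ℝⁿ` with bounded mean square oscillation over all large balls centred
at the origin is constant. -/
lemma harmonic_eq_of_osc_le (hu : ContDiff ℝ (⊤ : ℕ∞) u) (hharm : ∀ x, lap u x = 0)
    (hosc : ∀ R : ℝ, 1 < R → ∃ m : ℝ,
      ∫ x in ball (0 : EuclideanSpace ℝ (Fin n)) R, (u x - m) ^ 2 ≤
        volume.real (ball (0 : EuclideanSpace ℝ (Fin n)) R))
    (y z : EuclideanSpace ℝ (Fin n)) : u y = u z := by
  let c := ∫ x : EuclideanSpace ℝ (Fin n), radialWeight 1 x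
  have hc : 0 < c := integral_radialWeight_pos one_pos
  let K := 2 ^ n * volume.real (ball (0 : EuclideanSpace ℝ (Fin n)) 1) / c
  have hK (R m : ℝ) (hR : 0 < R)
      (h : ∫ x in ball (0 : EuclideanSpace ℝ (Fin n)) (2 * R), (u x - m) ^ 2 ≤
        volume.real (ball (0 : EuclideanSpace ℝ (Fin n)) (2 * R)))
      (w : EuclideanSpace ℝ (Fin n)) (hw : ‖w‖ ≤ R) : |u w - m| ≤ K := by
    have h1 := abs_sub_mul_integral_radialWeight_le hu hharm hR h hw
    rw [integral_radialWeight hR, Measure.real, Measure.addHaar_ball_of_pos _ _ (by positivity),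
      ENNReal.toReal_mul, ENNReal.toReal_ofReal (by positivity), finrank_euclideanSpace_fin] at h1
    rw [le_div_iff₀ hc]
    refine le_of_mul_le_mul_left (a := R ^ (n + 2)) ?_ (by positivity)
    calc R ^ (n + 2) * (|u w - m| * c) = |u w - m| * (R ^ (n + 2) * c) := by ring
      _ ≤ _ := h1
      _ = _ := by rw [Measure.real]; ring
  have hbelow (x : EuclideanSpace ℝ (Fin n)) : u 0 - 2 * K ≤ u x := by
    have hR : 0 < ‖x‖ + 1 := by positivity
    obtain ⟨m, hm⟩ := hosc (2 * (‖x‖ + 1)) (by linarith [norm_nonneg x])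
    have h0 := abs_le.1 (hK _ m hR hm 0 (by simpa using hR.le))
    have hx := abs_le.1 (hK _ m hR hm x (by linarith))
    linarith [h0.2, hx.1]
  exact le_antisymm (harmonic_le_of_bddBelow hu hharm hbelow y z)
    (harmonic_le_of_bddBelow hu hharm hbelow z y)

lemma eq_zero_of_setAverage_ball_eq_zero (hconst : ∀ x y, u x = u y)
    (havg : (⨍ x in ball (0 : EuclideanSpace ℝ (Fin n)) 1, u x) = 0)
    (x : EuclideanSpace ℝ (Fin n)) : u x = 0 := by
  rw [← havg, show u = fun _ => u x from funext fun y => hconst y x]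
  exact (setAverage_const (measure_ball_pos _ _ one_pos).ne' measure_ball_lt_top.ne _).symm

end Liouville

/-- Liouville-type rigidity for the blow-up limit: a smooth entire harmonic function
with vanishing averages of `v`, `∇v`, `D²v` over `B₁`, with `∫_{B_R}|D²v|² ≤ Rⁿ(1+Rⁿ)`
and `⨍_{B_R}|D²v − (D²v)̄_{B_R}|² ≤ 1` for all `R > 1`, must vanish identically. -/
theorem liouville_rigidity (n : ℕ) (hn : 1 ≤ n)
    (v : EuclideanSpace ℝ (Fin n) → ℝ) (hv : ContDiff ℝ (⊤ : ℕ∞) v)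
    (hharm : ∀ x, lap v x = 0)
    (havg : (⨍ x in ball (0 : EuclideanSpace ℝ (Fin n)) 1, v x) = 0)
    (hgrad : ∀ i, (⨍ x in ball (0 : EuclideanSpace ℝ (Fin n)) 1, partialDeriv' i v x) = 0)
    (hhess : ∀ i j, (⨍ x in ball (0 : EuclideanSpace ℝ (Fin n)) 1, hessEntry v i j x) = 0)
    (hgrowth : ∀ R : ℝ, 1 < R →
      (∫ x in ball (0 : EuclideanSpace ℝ (Fin n)) R, hessFrobSq v x) ≤ R ^ n * (1 + R ^ n))
    (hosc : ∀ R : ℝ, 1 < R →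
      (⨍ x in ball (0 : EuclideanSpace ℝ (Fin n)) R,
        ∑ i, ∑ j,
          (hessEntry v i j x -
            ⨍ z in ball (0 : EuclideanSpace ℝ (Fin n)) R, hessEntry v i j z) ^ 2) ≤ 1) :
    ∀ x, v x = 0 := by
  have hd (i : Fin n) : ContDiff ℝ (⊤ : ℕ∞) (partialDeriv' i v) := contDiff_partialDeriv' hv i
  have hH (i j : Fin n) : ContDiff ℝ (⊤ : ℕ∞) (hessEntry v i j) := contDiff_partialDeriv' (hd i) j
  have hHharm (i j : Fin n) (x) : lap (hessEntry v i j) x = 0 :=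
    lap_partialDeriv' (hd i) (lap_partialDeriv' hv hharm i) j x
  have hHosc (i j : Fin n) (R : ℝ) (hR : 1 < R) : ∃ m : ℝ,
      ∫ x in ball (0 : EuclideanSpace ℝ (Fin n)) R, (hessEntry v i j x - m) ^ 2 ≤
        volume.real (ball (0 : EuclideanSpace ℝ (Fin n)) R) := by
    refine ⟨⨍ z in ball (0 : EuclideanSpace ℝ (Fin n)) R, hessEntry v i j z, ?_⟩
    have hvol : 0 < volume.real (ball (0 : EuclideanSpace ℝ (Fin n)) R) :=
      
      ENNReal.toReal_pos (measure_ball_pos _ _ (by linarith)).ne' measure_ball_lt_top.ne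
    have h := hosc R hR
    rw [setAverage_eq, smul_eq_mul, inv_mul_le_iff₀ hvol, mul_one] at h
    have hcont (k l : Fin n) (m : ℝ) : Continuous fun x => (hessEntry v k l x - m) ^ 2 :=
      ((hH k l).continuous.sub continuous_const).pow 2
    have hsum : Continuous fun x => ∑ k, ∑ l, (hessEntry v k l x -
        ⨍ z in ball (0 : EuclideanSpace ℝ (Fin n)) R, hessEntry v k l z) ^ 2 :=
      continuous_finsetSum _ fun k _ => continuous_finsetSum _ fun l _ => hcont k l _
    refine le_trans (integral_mono_of_nonneg (.of_forall fun x => sq_nonneg _)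
      (integrableOn_ball_of_continuous hsum R) (.of_forall fun x => ?_)) h
    dsimp only
    refine le_trans ?_ (Finset.single_le_sum (fun k _ => Finset.sum_nonneg fun l _ => sq_nonneg _)
      (Finset.mem_univ i))
    exact Finset.single_le_sum (f := fun l => (hessEntry v i l x -
        ⨍ z in ball (0 : EuclideanSpace ℝ (Fin n)) R, hessEntry v i l z) ^ 2)
      (fun l _ => sq_nonneg _) (Finset.mem_univ j)
  have hH0 (i j : Fin n) : ∀ x, hessEntry v i j x = 0 :=
    eq_zero_of_setAverage_ball_eq_zero
      (harmonic_eq_of_osc_le (hH i j) (hHharm i j) (hHosc i j)) (hhess i j)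
  have hd0 (i : Fin n) : ∀ x, partialDeriv' i v x = 0 :=
    eq_zero_of_setAverage_ball_eq_zero (eq_of_partialDeriv'_eq_zero (hd i) (hH0 i)) (hgrad i)
  exact eq_zero_of_setAverage_ball_eq_zero (eq_of_partialDeriv'_eq_zero hv hd0) havg
end
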